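/- (Littlewood) The difference π(x) − Li(x) changes sign infinitely often: for every real X there exist x > X and y > X with π(x) > Li(x) and π(y) < Li(y), where π is the prime counting function and Li(x) = ∫₂^x dt / log t is the offset logarithmic integral. -/

import Mathlib

/-- The prime counting function π(x), the number of primes ≤ x. -/
noncomputable def primePi (x : ℝ) : ℕ := Nat.primeCounting ⌊x⌋₊

/-- The offset logarithmic integral Li(y) = ∫₂^y dt / log t. -/
noncomputable def Li (y : ℝ) : ℝ := ∫ t in (2 : ℝ)..y, 1 / Real.log t

namespace LittlewoodPi

open ProbabilityTheory MeasureTheory Set Metric Filter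

/-- Landau's lemma: the Laplace transform of a positive measure has a singularity at its abscissa
of convergence. -/
theorem exists_lt_mem_integrableExpSet {Ω : Type*} {m : MeasurableSpace Ω} {X : Ω → ℝ}
    {μ : Measure Ω} (hXm : Measurable X) (hX : ∀ᵐ ω ∂μ, X ω ≤ 0) {c δ : ℝ} (hδ : 0 < δ)
    (hI : Ioi c ⊆ integrableExpSet X μ) {Φ : ℂ → ℂ} (hΦ : DifferentiableOn ℂ Φ (ball (c : ℂ) δ))
    (heq : ∀ z ∈ ball (c : ℂ) δ, c < z.re → complexMGF X μ z = Φ z) :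
    ∃ c' < c, c' ∈ integrableExpSet X μ := by
  refine ⟨c - δ / 4, by linarith, ?_⟩
  set s₁ : ℝ := c + δ / 4 with hs₁
  set s₂ : ℝ := c - δ / 4 with hs₂
  have hsub : ball (s₁ : ℂ) (3 * δ / 4) ⊆ ball (c : ℂ) δ := by
    apply ball_subset_ball'
    rw [Complex.dist_eq, ← Complex.ofReal_sub, Complex.norm_real, hs₁, Real.norm_eq_abs,
      abs_of_nonneg (by linarith)]
    linarith
  have hs₂mem : (s₂ : ℂ) ∈ ball (s₁ : ℂ) (3 * δ / 4) := by
    rw [mem_ball, Complex.dist_eq, ← Complex.ofReal_sub, Complex.norm_real, Real.norm_eq_abs,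
      abs_of_nonpos (by linarith)]
    linarith
  have h_interior : s₁ ∈ interior (integrableExpSet X μ) :=
    interior_mono hI (by rw [interior_Ioi]; simp [hs₁, hδ])
  have htay := Complex.hasSum_taylorSeries_on_ball (hΦ.mono hsub) hs₂mem
  have hev : complexMGF X μ =ᶠ[nhds (s₁ : ℂ)] Φ := by
    have h1 : ∀ᶠ z in nhds (s₁ : ℂ), z ∈ ball (c : ℂ) δ :=
      isOpen_ball.mem_nhds (hsub (mem_ball_self (by linarith)))
    have h2 : ∀ᶠ z : ℂ in nhds (s₁ : ℂ), c < z.re :=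
      (Complex.continuous_re.isOpen_preimage _ isOpen_Ioi).mem_nhds (by simp [hs₁, hδ])
    filter_upwards [h1, h2] with z hz1 hz2 using heq z hz1 hz2
  let g : ℕ → Ω → ℝ := fun n ω =>
    ((n.factorial : ℝ)⁻¹ * (s₂ - s₁) ^ n) * (X ω ^ n * Real.exp (s₁ * X ω))
  have hgint (n : ℕ) : Integrable (g n) μ := by
    refine Integrable.const_mul ?_ _
    refine integrable_pow_mul_exp_of_integrable_exp_mul (t := δ / 8) (by positivity) ?_ ?_ n
    · exact hI (by simp only [mem_Ioi]; linarith)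
    · exact hI (by simp only [mem_Ioi]; linarith)
  have hterm (n : ℕ) : (n.factorial : ℂ)⁻¹ • ((s₂ : ℂ) - s₁) ^ n • iteratedDeriv n Φ (s₁ : ℂ)
      = ((∫ ω, g n ω ∂μ : ℝ) : ℂ) := by
    rw [← hev.iteratedDeriv_eq, iteratedDeriv_complexMGF (by simpa using h_interior)]
    simp only [g]
    rw [integral_const_mul, smul_eq_mul, smul_eq_mul]
    push_cast
    rw [mul_assoc]
    congr 2
    rw [← integral_complex_ofReal]
    congr 1
    ext ω
    push_cast
    rfl
  have hg0 (n : ℕ) : ∀ᵐ ω ∂μ, 0 ≤ g n ω := by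
    filter_upwards [hX] with ω hω
    have : g n ω = (n.factorial : ℝ)⁻¹ * ((s₂ - s₁) * X ω) ^ n * Real.exp (s₁ * X ω) := by
      simp only [g]; rw [mul_pow]; ring
    rw [this]
    have : 0 ≤ (s₂ - s₁) * X ω := mul_nonneg_of_nonpos_of_nonpos (by linarith) hω
    positivity
  have hsum : Summable fun n => ∫ ω, g n ω ∂μ := by
    have := htay.summable
    simp only [hterm] at this
    exact_mod_cast this
  have hexp (ω : Ω) : HasSum (fun n => g n ω) (Real.exp (s₂ * X ω)) := by
    have h := (NormedSpace.expSeries_div_hasSum_exp ((s₂ - s₁) * X ω)).mul_right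
      (Real.exp (s₁ * X ω))
    rw [← Real.exp_eq_exp_ℝ, ← Real.exp_add] at h
    rw [show s₂ * X ω = (s₂ - s₁) * X ω + s₁ * X ω by ring]
    have e : (fun n => g n ω) = fun n : ℕ => ((s₂ - s₁) * X ω) ^ n / (n.factorial : ℝ) *
        Real.exp (s₁ * X ω) := by
      funext n
      simp only [g]
      rw [mul_pow]
      field_simp
    rw [e]
    exact h
  refine ⟨by fun_prop, ?_⟩
  rw [hasFiniteIntegral_iff_ofReal (ae_of_all _ fun _ => (Real.exp_pos _).le)]
  have hall : ∀ᵐ ω ∂μ, ∀ n, 0 ≤ g n ω := ae_all_iff.2 hg0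
  calc ∫⁻ ω, ENNReal.ofReal (Real.exp (s₂ * X ω)) ∂μ
      = ∫⁻ ω, ∑' n, ENNReal.ofReal (g n ω) ∂μ := by
        refine lintegral_congr_ae ?_
        filter_upwards [hall] with ω hω
        rw [← (hexp ω).tsum_eq, ENNReal.ofReal_tsum_of_nonneg hω (hexp ω).summable]
    _ = ∑' n, ∫⁻ ω, ENNReal.ofReal (g n ω) ∂μ :=
        lintegral_tsum fun n => (hgint n).aemeasurable.ennreal_ofReal
    _ = ∑' n, ENNReal.ofReal (∫ ω, g n ω ∂μ) := by
        refine tsum_congr fun n => ?_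
        rw [ofReal_integral_eq_lintegral_ofReal (hgint n) (hg0 n)]
    _ = ENNReal.ofReal (∑' n, ∫ ω, g n ω ∂μ) :=
        (ENNReal.ofReal_tsum_of_nonneg (fun n => integral_nonneg_of_ae (hg0 n)) hsum).symm
    _ < ⊤ := ENNReal.ofReal_lt_top

end LittlewoodPi

namespace LittlewoodPi

open Complex Set Metric Filter Topology

/-- The completed zeta function with its poles removed: `s (s - 1) Λ(s)`. -/
noncomputable def xi (s : ℂ) : ℂ := s * (s - 1) * completedRiemannZeta₀ s + 1

/-- The entire function `(s - 1) ζ(s)`. -/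
noncomputable def zetaMul : ℂ → ℂ := Function.update (fun s => (s - 1) * riemannZeta s) 1 1

theorem differentiable_xi : Differentiable ℂ xi := by
  have := differentiable_completedZeta₀
  unfold xi
  fun_prop

theorem xi_one_sub (s : ℂ) : xi (1 - s) = xi s := by
  unfold xi
  rw [completedRiemannZeta₀_one_sub]
  ring

theorem xi_one : xi 1 = 1 := by simp [xi]

theorem xi_eq_completedRiemannZeta {s : ℂ} (h0 : s ≠ 0) (h1 : s ≠ 1) :
    xi s = s * (s - 1) * completedRiemannZeta s := by
  rw [completedRiemannZeta_eq, xi]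
  have : 1 - s ≠ 0 := sub_ne_zero.2 (Ne.symm h1)
  field_simp
  ring

theorem zetaMul_one : zetaMul 1 = 1 := by simp [zetaMul]

theorem zetaMul_of_ne_one {s : ℂ} (h : s ≠ 1) : zetaMul s = (s - 1) * riemannZeta s := by
  simp [zetaMul, h]

theorem differentiable_zetaMul : Differentiable ℂ zetaMul := by
  rw [← differentiableOn_univ,
    ← differentiableOn_compl_singleton_and_continuousAt_iff (c := (1 : ℂ)) univ_mem]
  constructor
  · refine DifferentiableOn.congr (f := fun s => (s - 1) * riemannZeta s) ?_
      fun s hs => zetaMul_of_ne_one (by simpa using hs)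
    intro s hs
    have := differentiableAt_riemannZeta (s := s) (by simpa using hs)
    exact DifferentiableAt.differentiableWithinAt (by fun_prop)
  · rw [zetaMul, continuousAt_update_same]
    exact riemannZeta_residue_one

theorem xi_eq_mul_zetaMul {s : ℂ} (hs : 0 < s.re) : xi s = s * Gammaℝ s * zetaMul s := by
  by_cases h1 : s = 1
  · subst h1; simp [xi_one, zetaMul_one, Gammaℝ_one]
  have h0 : s ≠ 0 := by rintro rfl; simp at hs
  rw [xi_eq_completedRiemannZeta h0 h1, zetaMul_of_ne_one h1, riemannZeta_def_of_ne_zero h0]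
  have := Gammaℝ_ne_zero_of_re_pos hs
  field_simp

theorem mul_Gammaℝ_ne_zero {s : ℂ} (hs : 0 < s.re) : s * Gammaℝ s ≠ 0 :=
  mul_ne_zero (by rintro rfl; simp at hs) (Gammaℝ_ne_zero_of_re_pos hs)

theorem xi_eq_zero_iff {s : ℂ} (hs : 0 < s.re) : xi s = 0 ↔ zetaMul s = 0 := by
  rw [xi_eq_mul_zetaMul hs, mul_eq_zero, or_iff_right (mul_Gammaℝ_ne_zero hs)]

theorem dslope_zetaMul {s : ℂ} (h : s ≠ 1) :
    dslope zetaMul 1 s = riemannZeta s - 1 / (s - 1) := by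
  rw [dslope_of_ne _ h, slope_def_field, zetaMul_one, zetaMul_of_ne_one h]
  have : s - 1 ≠ 0 := sub_ne_zero.2 h
  field_simp

theorem differentiable_dslope_zetaMul : Differentiable ℂ (dslope zetaMul 1) := by
  rw [← differentiableOn_univ, Complex.differentiableOn_dslope univ_mem]
  exact differentiable_zetaMul.differentiableOn

theorem zetaMul_ne_zero_of_one_le_re {s : ℂ} (hs : 1 ≤ s.re) : zetaMul s ≠ 0 := by
  by_cases h1 : s = 1
  · simp [h1, zetaMul_one]
  · rw [zetaMul_of_ne_one h1]
    exact mul_ne_zero (sub_ne_zero.2 h1) (riemannZeta_ne_zero_of_one_le_re hs)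

theorem deriv_zetaMul_div {s : ℂ} (h1 : s ≠ 1) (hz : riemannZeta s ≠ 0) :
    deriv zetaMul s / zetaMul s = 1 / (s - 1) + deriv riemannZeta s / riemannZeta s := by
  have hev : zetaMul =ᶠ[𝓝 s] fun s => (s - 1) * riemannZeta s := by
    filter_upwards [isOpen_ne.mem_nhds h1] with w hw using zetaMul_of_ne_one hw
  have hd : HasDerivAt (fun s => (s - 1) * riemannZeta s)
      (1 * riemannZeta s + (s - 1) * deriv riemannZeta s) s :=
    ((hasDerivAt_id s).sub_const 1).mul (differentiableAt_riemannZeta h1).hasDerivAt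
  rw [hev.deriv_eq, hd.deriv, zetaMul_of_ne_one h1]
  have : s - 1 ≠ 0 := sub_ne_zero.2 h1
  field_simp

theorem norm_Gamma_le {s : ℂ} (hs : 0 < s.re) : ‖Complex.Gamma s‖ ≤ Real.Gamma s.re := by
  rw [Complex.Gamma_eq_integral hs, Real.Gamma_eq_integral hs, Complex.GammaIntegral]
  refine (MeasureTheory.norm_integral_le_integral_norm _).trans_eq ?_
  refine MeasureTheory.setIntegral_congr_fun measurableSet_Ioi fun x hx => ?_
  simp only [norm_mul, Complex.norm_real, Real.norm_eq_abs, abs_of_pos (Real.exp_pos _)]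
  rw [Complex.norm_cpow_eq_rpow_re_of_pos hx]
  simp

theorem Gamma_le_exp {x : ℝ} (hx : 1 ≤ x) : Real.Gamma x ≤ Real.exp (2 * x ^ (3 / 2 : ℝ)) := by
  rcases le_total x 2 with h2 | h2
  · have h := Real.convexOn_Gamma.2 (show (1 : ℝ) ∈ Ioi 0 by simp)
      (show (2 : ℝ) ∈ Ioi 0 by simp) (show 0 ≤ 2 - x by linarith) (show 0 ≤ x - 1 by linarith)
      (by ring)
    simp only [smul_eq_mul, Real.Gamma_one, Real.Gamma_two] at h
    rw [show (2 - x) * 1 + (x - 1) * 2 = x by ring] at h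
    refine (h.trans_eq (by ring)).trans (Real.one_le_exp (by positivity))
  · have hn : (1 : ℝ) ≤ ⌊x⌋₊ := by exact_mod_cast Nat.le_floor (by simpa using hx)
    have hfx : (⌊x⌋₊ : ℝ) ≤ x := Nat.floor_le (by linarith)
    calc Real.Gamma x ≤ Real.Gamma (⌊x⌋₊ + 1) :=
          Real.Gamma_strictMonoOn_Ici.monotoneOn h2 (by simp; linarith)
            (Nat.lt_floor_add_one x).le
      _ = (⌊x⌋₊.factorial : ℝ) := Real.Gamma_nat_eq_factorial _
      _ ≤ (⌊x⌋₊ : ℝ) ^ ⌊x⌋₊ := by exact_mod_cast Nat.factorial_le_pow _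
      _ = Real.exp (Real.log ⌊x⌋₊ * ⌊x⌋₊) := by
          rw [← Real.rpow_natCast, Real.rpow_def_of_pos (by linarith)]
      _ ≤ Real.exp (2 * x ^ (3 / 2 : ℝ)) := by
          refine Real.exp_le_exp.2 ?_
          have h1 : Real.log ⌊x⌋₊ ≤ x ^ (1 / 2 : ℝ) / (1 / 2) :=
            (Real.log_le_log (by linarith) hfx).trans
              (Real.log_le_rpow_div (by linarith) (by norm_num))
          calc Real.log ⌊x⌋₊ * ⌊x⌋₊ ≤ x ^ (1 / 2 : ℝ) / (1 / 2) * x :=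
                mul_le_mul h1 hfx (by positivity) (by positivity)
            _ = 2 * x ^ (3 / 2 : ℝ) := by
                rw [show (3 / 2 : ℝ) = 1 / 2 + 1 by norm_num, Real.rpow_add_one (by linarith)]
                ring

end LittlewoodPi

namespace LittlewoodPi

open ProbabilityTheory MeasureTheory Set Metric Filter

/-- The measure `h(t) dt / t` on `(1, ∞)`. -/
noncomputable def mellinMeasure (h : ℝ → ℝ) : Measure ℝ :=
  (volume.restrict (Ioi 1)).withDensity fun t => ENNReal.ofReal (h t / t)

/-- The set of real `σ` for which `∫₁^∞ h(t) t^{-σ-1} dt` converges. -/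
abbrev mellinSet (h : ℝ → ℝ) : Set ℝ := integrableExpSet (fun t => -Real.log t) (mellinMeasure h)

/-- The one-sided Mellin transform `∫₁^∞ h(t) t^{-s-1} dt`. -/
noncomputable def mellinOne (h : ℝ → ℝ) : ℂ → ℂ :=
  complexMGF (fun t => -Real.log t) (mellinMeasure h)

variable {h : ℝ → ℝ}

theorem mellinMeasure_ae_nonpos : ∀ᵐ t ∂(mellinMeasure h), -Real.log t ≤ 0 := by
  have : ∀ᵐ t ∂(volume.restrict (Ioi (1 : ℝ))), -Real.log t ≤ 0 := by
    filter_upwards [ae_restrict_mem measurableSet_Ioi] with t ht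
    simpa using Real.log_nonneg (le_of_lt ht)
  exact (withDensity_absolutelyContinuous _ _).ae_le this

theorem integral_mellinMeasure (hm : Measurable h) (h0 : ∀ t, 1 < t → 0 ≤ h t) (g : ℝ → ℂ) :
    ∫ t, g t ∂(mellinMeasure h) = ∫ t in Ioi 1, (h t / t : ℝ) • g t := by
  rw [mellinMeasure, integral_withDensity_eq_integral_toReal_smul₀ (by fun_prop) (by simp)]
  refine setIntegral_congr_fun measurableSet_Ioi fun t ht => ?_
  have : 0 ≤ h t / t := div_nonneg (h0 t ht) (by linarith [mem_Ioi.1 ht])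
  simp only [ENNReal.toReal_ofReal this]

theorem mellinOne_eq (hm : Measurable h) (h0 : ∀ t, 1 < t → 0 ≤ h t) (s : ℂ) :
    mellinOne h s = ∫ t in Ioi (1 : ℝ), (h t : ℂ) * (t : ℂ) ^ (-(s + 1)) := by
  rw [mellinOne, complexMGF, integral_mellinMeasure hm h0]
  refine setIntegral_congr_fun measurableSet_Ioi fun t ht => ?_
  have ht0 : (0 : ℝ) < t := by linarith [mem_Ioi.1 ht]
  have ht0' : (t : ℂ) ≠ 0 := by exact_mod_cast ht0.ne'
  simp only [Complex.real_smul]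
  rw [neg_add, Complex.cpow_add _ _ ht0', Complex.cpow_neg_one, Complex.cpow_def_of_ne_zero ht0',
    ← Complex.ofReal_log ht0.le]
  push_cast
  rw [div_eq_mul_inv]
  ring_nf

theorem mem_mellinSet_iff (hm : Measurable h) (h0 : ∀ t, 1 < t → 0 ≤ h t) (σ : ℝ) :
    σ ∈ mellinSet h ↔ IntegrableOn (fun t => h t * t ^ (-(σ + 1))) (Ioi 1) := by
  rw [mellinSet, integrableExpSet, mem_ofPred_eq, mellinMeasure,
    integrable_withDensity_iff_integrable_smul' (by fun_prop) (by simp)]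
  refine integrable_congr ?_
  filter_upwards [ae_restrict_mem measurableSet_Ioi] with t ht
  have ht0 : (0 : ℝ) < t := by linarith [mem_Ioi.1 ht]
  have : 0 ≤ h t / t := div_nonneg (h0 t ht) ht0.le
  rw [ENNReal.toReal_ofReal this, neg_add, Real.rpow_add ht0, Real.rpow_neg_one,
    Real.rpow_def_of_pos ht0, smul_eq_mul]
  rw [div_eq_mul_inv]
  ring_nf

theorem mellinSet_upward (hm : Measurable h) (h0 : ∀ t, 1 < t → 0 ≤ h t) {σ τ : ℝ} (hστ : σ ≤ τ)
    (hσ : σ ∈ mellinSet h) : τ ∈ mellinSet h := by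
  rw [mem_mellinSet_iff hm h0] at hσ ⊢
  refine hσ.mono' (by fun_prop) ?_
  filter_upwards [ae_restrict_mem measurableSet_Ioi] with t ht
  have ht1 : (1 : ℝ) < t := ht
  rw [Real.norm_eq_abs, abs_mul, abs_of_nonneg (h0 t ht),
    abs_of_nonneg (Real.rpow_nonneg (by linarith) _)]
  exact mul_le_mul_of_nonneg_left (Real.rpow_le_rpow_of_exponent_le ht1.le (by linarith)) (h0 t ht)

theorem Ioi_subset_mellinSet_of_le_rpow (hm : Measurable h) (h0 : ∀ t, 1 < t → 0 ≤ h t)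
    {C r : ℝ} (hC : ∀ t, 1 < t → h t ≤ C * t ^ r) : Ioi r ⊆ mellinSet h := by
  intro σ hσ
  rw [mem_mellinSet_iff hm h0]
  have hσ' : r < σ := hσ
  have : IntegrableOn (fun t : ℝ => C * t ^ (r - σ - 1)) (Ioi 1) :=
    (integrableOn_Ioi_rpow_of_lt (by linarith) one_pos).const_mul _
  refine this.mono' (by fun_prop) ?_
  filter_upwards [ae_restrict_mem measurableSet_Ioi] with t ht
  have ht1 : (1 : ℝ) < t := ht
  rw [Real.norm_eq_abs, abs_mul, abs_of_nonneg (h0 t ht),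
    abs_of_nonneg (Real.rpow_nonneg (by linarith) _)]
  refine (mul_le_mul_of_nonneg_right (hC t ht) (Real.rpow_nonneg (by linarith) _)).trans_eq ?_
  rw [mul_assoc, ← Real.rpow_add (by linarith)]
  ring_nf

theorem differentiableOn_mellinOne {c : ℝ} (hc : Ioi c ⊆ mellinSet h) :
    DifferentiableOn ℂ (mellinOne h) {s | c < s.re} := by
  refine differentiableOn_complexMGF.mono fun s hs => ?_
  have := interior_mono hc
  rw [interior_Ioi] at this
  exact this hs

theorem isOpen_re_gt (c : ℝ) : IsOpen {s : ℂ | c < s.re} :=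
  Complex.continuous_re.isOpen_preimage _ isOpen_Ioi

theorem isPreconnected_re_gt (c : ℝ) : IsPreconnected {s : ℂ | c < s.re} :=
  (convex_halfSpace_re_gt c).isPreconnected

/-- Two holomorphic functions on a right half-plane which agree further right agree. -/
theorem eqOn_re_gt {f g : ℂ → ℂ} {c d : ℝ} (hf : DifferentiableOn ℂ f {s | c < s.re})
    (hg : DifferentiableOn ℂ g {s | c < s.re}) (h : ∀ s : ℂ, d < s.re → f s = g s) :
    EqOn f g {s | c < s.re} := by
  refine (hf.analyticOnNhd (isOpen_re_gt c)).eqOn_of_preconnected_of_eventuallyEq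
    (hg.analyticOnNhd (isOpen_re_gt c)) (isPreconnected_re_gt c)
    (z₀ := ((max c d + 1 : ℝ) : ℂ)) ?_ ?_
  · simp only [mem_ofPred_eq, Complex.ofReal_re]
    linarith [le_max_left c d]
  · filter_upwards [(isOpen_re_gt d).mem_nhds (x := ((max c d + 1 : ℝ) : ℂ))
      (by simp only [mem_ofPred_eq, Complex.ofReal_re]; linarith [le_max_right c d])] with s hs
    exact h s hs

end LittlewoodPi

namespace LittlewoodPi

open ProbabilityTheory MeasureTheory Set Metric Filter

theorem Ioi_zero_subset_mellinSet_fract : Ioi 0 ⊆ mellinSet (Int.fract : ℝ → ℝ) :=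
  Ioi_subset_mellinSet_of_le_rpow (C := 1) measurable_fract (fun t _ => Int.fract_nonneg t)
    fun t _ => by simpa using (Int.fract_lt_one t).le

theorem riemannZeta_eq_sub_mellinOne_fract {s : ℂ} (hs : 1 < s.re) :
    riemannZeta s = s * (1 / (s - 1) - mellinOne Int.fract s) := by
  have hs1 : s - 1 ≠ 0 := by
    intro h
    rw [sub_eq_zero.1 h] at hs
    simp at hs
  have hO : (fun n : ℕ => ∑ k ∈ Finset.Icc 1 n, ‖(1 : ℕ → ℂ) k‖) =O[atTop]
      fun n : ℕ => (n : ℝ) ^ (1 : ℝ) := by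
    simp only [Pi.one_apply, norm_one, Finset.sum_const, Nat.card_Icc, add_tsub_cancel_right,
      nsmul_eq_mul, mul_one, Real.rpow_one]
    exact Asymptotics.isBigO_refl _ _
  rw [← LSeries_one_eq_riemannZeta hs, LSeries_eq_mul_integral' 1 zero_le_one hs hO,
    mellinOne_eq measurable_fract (fun t _ => Int.fract_nonneg t)]
  congr 1
  have h1 : ∫ t in Ioi (1 : ℝ), (t : ℂ) ^ (-s) = 1 / (s - 1) := by
    rw [integral_Ioi_cpow_of_lt (by simpa using hs) one_pos]
    rw [Complex.ofReal_one, Complex.one_cpow, show -s + 1 = -(s - 1) by ring]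
    field_simp
  have h_int : IntegrableOn (fun t : ℝ => ((Int.fract t : ℝ) : ℂ) * (t : ℂ) ^ (-(s + 1)))
      (Ioi 1) := by
    refine Integrable.mono' (integrableOn_Ioi_rpow_of_lt (a := -(s.re + 1)) (by linarith) one_pos)
      (by fun_prop) ?_
    filter_upwards [ae_restrict_mem measurableSet_Ioi] with t ht
    have ht0 : (0 : ℝ) < t := by linarith [mem_Ioi.1 ht]
    rw [norm_mul, Complex.norm_real, Complex.norm_cpow_eq_rpow_re_of_pos ht0, Real.norm_eq_abs,
      abs_of_nonneg (Int.fract_nonneg t)]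
    simpa using mul_le_of_le_one_left (Real.rpow_nonneg ht0.le _) (Int.fract_lt_one t).le
  rw [← h1, ← integral_sub (integrableOn_Ioi_cpow_of_lt (by simpa using hs) one_pos) h_int]
  refine setIntegral_congr_fun measurableSet_Ioi fun t ht => ?_
  have ht0 : (0 : ℝ) < t := by linarith [mem_Ioi.1 ht]
  have ht0' : (t : ℂ) ≠ 0 := by exact_mod_cast ht0.ne'
  have hfl : ((Int.fract t : ℝ) : ℂ) = (t : ℂ) - ((⌊t⌋₊ : ℕ) : ℂ) := by
    rw [Int.fract, ← natCast_floor_eq_intCast_floor ht0.le]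
    push_cast
    rfl
  simp only [Pi.one_apply, Finset.sum_const, Nat.card_Icc, add_tsub_cancel_right, nsmul_eq_mul,
    mul_one, hfl]
  rw [sub_mul, show (-s : ℂ) = 1 + (-(s + 1)) by ring, Complex.cpow_add _ _ ht0',
    Complex.cpow_one]
  ring

theorem zetaMul_eq_sub_mellinOne_fract {s : ℂ} (hs : 0 < s.re) :
    zetaMul s = s - (s - 1) * s * mellinOne Int.fract s := by
  have hd := differentiableOn_mellinOne Ioi_zero_subset_mellinSet_fract
  refine eqOn_re_gt (f := zetaMul) (g := fun s => s - (s - 1) * s * mellinOne Int.fract s) (d := 1)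
    differentiable_zetaMul.differentiableOn (by fun_prop) (fun s hs => ?_) hs
  have h1 : s ≠ 1 := by rintro rfl; simp at hs
  have : s - 1 ≠ 0 := sub_ne_zero.2 h1
  rw [zetaMul_of_ne_one h1, riemannZeta_eq_sub_mellinOne_fract hs]
  field_simp

theorem zetaMul_ofReal_ne_zero {σ : ℝ} (h0 : 0 < σ) : zetaMul σ ≠ 0 := by
  rcases le_or_gt 1 σ with h1 | h1
  · exact zetaMul_ne_zero_of_one_le_re (by simpa using h1)
  rw [zetaMul_eq_sub_mellinOne_fract (by simpa using h0), mellinOne, complexMGF_ofReal]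
  set M := mgf (fun t => -Real.log t) (mellinMeasure (Int.fract : ℝ → ℝ)) σ with hM
  have hM0 : 0 ≤ M := mgf_nonneg
  have : 0 < σ - (σ - 1) * σ * M := by
    have : 0 ≤ (1 - σ) * σ * M := by
      have : 0 ≤ 1 - σ := by linarith
      positivity
    nlinarith
  exact_mod_cast this.ne'

theorem norm_mellinOne_fract_le {s : ℂ} (hs : 1 / 2 ≤ s.re) : ‖mellinOne Int.fract s‖ ≤ 2 := by
  rw [mellinOne_eq measurable_fract (fun t _ => Int.fract_nonneg t)]
  have : ∫ t in Ioi (1 : ℝ), t ^ (-(3 / 2) : ℝ) = 2 := by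
    rw [integral_Ioi_rpow_of_lt (by norm_num) one_pos]
    norm_num
  rw [← this]
  refine norm_integral_le_of_norm_le (integrableOn_Ioi_rpow_of_lt (by norm_num) one_pos) ?_
  filter_upwards [ae_restrict_mem measurableSet_Ioi] with t ht
  have ht1 : (1 : ℝ) < t := ht
  rw [norm_mul, Complex.norm_real, Complex.norm_cpow_eq_rpow_re_of_pos (by linarith),
    Real.norm_eq_abs, abs_of_nonneg (Int.fract_nonneg t)]
  refine (mul_le_of_le_one_left (Real.rpow_nonneg (by linarith) _) (Int.fract_lt_one t).le).trans ?_
  refine Real.rpow_le_rpow_of_exponent_le ht1.le ?_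
  simp only [Complex.neg_re, Complex.add_re, Complex.one_re]
  linarith

theorem norm_mul_Gammaℝ_le {s : ℂ} (hs : 0 < s.re) :
    ‖s * Complex.Gammaℝ s‖ ≤ 2 * Real.exp (2 * (s.re / 2 + 1) ^ (3 / 2 : ℝ)) := by
  have hs0 : s / 2 ≠ 0 := by
    intro h
    have : s = 0 := by simpa using h
    simp [this] at hs
  have h1 : s * Complex.Gammaℝ s = 2 * ((Real.pi : ℂ) ^ (-s / 2) * Complex.Gamma (s / 2 + 1)) := by
    rw [Complex.Gammaℝ_def, Complex.Gamma_add_one _ hs0]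
    ring
  have hre : (s / 2 + 1).re = s.re / 2 + 1 := by simp
  rw [h1, norm_mul, norm_mul, Complex.norm_cpow_eq_rpow_re_of_pos Real.pi_pos, Complex.norm_ofNat]
  refine mul_le_mul_of_nonneg_left ?_ zero_le_two
  have h2 : ‖Complex.Gamma (s / 2 + 1)‖ ≤ Real.exp (2 * (s.re / 2 + 1) ^ (3 / 2 : ℝ)) := by
    rw [← hre]
    exact (norm_Gamma_le (by rw [hre]; linarith)).trans (Gamma_le_exp (by rw [hre]; linarith))
  have h3 : Real.pi ^ (-s / 2).re ≤ 1 := by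
    refine Real.rpow_le_one_of_one_le_of_nonpos (by linarith [Real.pi_gt_three]) ?_
    simp
    linarith
  exact (mul_le_of_le_one_left (norm_nonneg _) h3).trans h2

theorem norm_xi_le_of_half_le_re {s : ℂ} {R : ℝ} (hR : 1 ≤ R) (hs : 1 / 2 ≤ s.re) (hsR : ‖s‖ ≤ R) :
    ‖xi s‖ ≤ Real.exp (16 * R ^ (3 / 2 : ℝ)) := by
  have hs0 : 0 < s.re := by linarith
  have hRR : R ≤ R ^ (3 / 2 : ℝ) := Real.self_le_rpow_of_one_le hR (by norm_num)
  have hZ : ‖zetaMul s‖ ≤ 5 * R ^ 2 := by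
    rw [zetaMul_eq_sub_mellinOne_fract hs0]
    calc ‖s - (s - 1) * s * mellinOne Int.fract s‖
        ≤ ‖s‖ + ‖(s - 1)‖ * ‖s‖ * ‖mellinOne Int.fract s‖ := by
          refine (norm_sub_le _ _).trans_eq ?_
          rw [norm_mul, norm_mul]
      _ ≤ R + (R + 1) * R * 2 := by
          have : ‖s - 1‖ ≤ R + 1 := (norm_sub_le _ _).trans (by simpa using hsR)
          have := norm_mellinOne_fract_le hs
          gcongr
      _ ≤ 5 * R ^ 2 := by nlinarith
  have hG : ‖s * Complex.Gammaℝ s‖ ≤ 2 * Real.exp (6 * R ^ (3 / 2 : ℝ)) := by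
    refine (norm_mul_Gammaℝ_le hs0).trans ?_
    have h1 : s.re / 2 + 1 ≤ 2 * R := by linarith [(Complex.re_le_norm s).trans hsR]
    have h2 : (s.re / 2 + 1) ^ (3 / 2 : ℝ) ≤ 3 * R ^ (3 / 2 : ℝ) := by
      refine (Real.rpow_le_rpow (by linarith) h1 (by norm_num)).trans ?_
      rw [Real.mul_rpow (by norm_num) (by linarith)]
      refine mul_le_mul_of_nonneg_right ?_ (by positivity)
      rw [show (3 / 2 : ℝ) = 1 + 1 / 2 by norm_num, Real.rpow_add (by norm_num), Real.rpow_one,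
        ← Real.sqrt_eq_rpow]
      nlinarith [Real.sqrt_nonneg 2, Real.sq_sqrt (show (0 : ℝ) ≤ 2 by norm_num)]
    have : Real.exp (2 * (s.re / 2 + 1) ^ (3 / 2 : ℝ)) ≤ Real.exp (6 * R ^ (3 / 2 : ℝ)) :=
      Real.exp_le_exp.2 (by linarith)
    linarith
  rw [xi_eq_mul_zetaMul hs0, norm_mul]
  calc ‖s * Complex.Gammaℝ s‖ * ‖zetaMul s‖
      ≤ 2 * Real.exp (6 * R ^ (3 / 2 : ℝ)) * (5 * R ^ 2) := by gcongr
    _ ≤ Real.exp (6 * R ^ (3 / 2 : ℝ)) * Real.exp (10 * R) := by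
        have := Real.quadratic_le_exp_of_nonneg (x := 10 * R) (by linarith)
        have h2 : 10 * R ^ 2 ≤ Real.exp (10 * R) := by nlinarith
        nlinarith [Real.exp_pos (6 * R ^ (3 / 2 : ℝ))]
    _ ≤ Real.exp (16 * R ^ (3 / 2 : ℝ)) := by
        rw [← Real.exp_add]
        exact Real.exp_le_exp.2 (by linarith)

theorem norm_xi_half_add_le {z : ℂ} {R : ℝ} (hR : 1 ≤ R) (hz : ‖z‖ ≤ R) :
    ‖xi (1 / 2 + z)‖ ≤ Real.exp (48 * R ^ (3 / 2 : ℝ)) := by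
  have key (w : ℂ) (hw : ‖w‖ ≤ R) (hre : 0 ≤ w.re) :
      ‖xi (1 / 2 + w)‖ ≤ Real.exp (48 * R ^ (3 / 2 : ℝ)) := by
    have h1 : ‖1 / 2 + w‖ ≤ 2 * R := by
      refine (norm_add_le _ _).trans ?_
      norm_num
      linarith
    refine (norm_xi_le_of_half_le_re (R := 2 * R) (by linarith) (by simpa using hre) h1).trans ?_
    refine Real.exp_le_exp.2 ?_
    rw [Real.mul_rpow (by norm_num) (by linarith), ← mul_assoc]
    refine mul_le_mul_of_nonneg_right ?_ (by positivity)
    rw [show (3 / 2 : ℝ) = 1 + 1 / 2 by norm_num, Real.rpow_add (by norm_num), Real.rpow_one,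
      ← Real.sqrt_eq_rpow]
    nlinarith [Real.sqrt_nonneg 2, Real.sq_sqrt (show (0 : ℝ) ≤ 2 by norm_num)]
  rcases le_total 0 z.re with h | h
  · exact key z hz h
  · rw [← xi_one_sub, show 1 - (1 / 2 + z) = 1 / 2 + -z by ring]
    exact key (-z) (by simpa using hz) (by simpa using h)

end LittlewoodPi

namespace LittlewoodPi

open ProbabilityTheory MeasureTheory Set Metric Filter Topology

/-- `log n` on primes, `0` elsewhere. -/
noncomputable def primeLog (n : ℕ) : ℝ := if n.Prime then Real.log n else 0

/-- The von Mangoldt function off the primes. -/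
noncomputable def vonMangoldtRest (n : ℕ) : ℝ :=
  if n.Prime then 0 else ArithmeticFunction.vonMangoldt n

/-- `log p` on squares `p ^ 2` of primes, `0` elsewhere. -/
noncomputable def primeSqLog (n : ℕ) : ℝ := if IsSquare n then primeLog n.sqrt else 0

theorem lSeriesSummable_of_sum_le {g : ℕ → ℝ} (h0 : ∀ n, 0 ≤ g n) {C r : ℝ} (hr : 0 ≤ r)
    (hC : ∀ n : ℕ, ∑ k ∈ Finset.Icc 1 n, g k ≤ C * (n : ℝ) ^ r) {s : ℂ} (hs : r < s.re) :
    LSeriesSummable (fun n => (g n : ℂ)) s := by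
  refine LSeriesSummable_of_sum_norm_bigO_and_nonneg ?_ h0 hr hs
  refine Asymptotics.IsBigO.of_bound C (Eventually.of_forall fun n => ?_)
  rw [Real.norm_eq_abs, abs_of_nonneg (Finset.sum_nonneg fun i _ => h0 i), Real.norm_eq_abs,
    abs_of_nonneg (by positivity)]
  exact hC n

theorem differentiableOn_lSeries_of_summable {f : ℕ → ℂ} {r : ℝ}
    (h : ∀ s : ℂ, r < s.re → LSeriesSummable f s) :
    DifferentiableOn ℂ (LSeries f) {s | r < s.re} := by
  refine (LSeries_differentiableOn f).mono fun s hs => ?_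
  have h1 : LSeries.abscissaOfAbsConv f ≤ r :=
    LSeries.abscissaOfAbsConv_le_of_forall_lt_LSeriesSummable fun y hy => h y (by simpa using hy)
  exact h1.trans_lt (by exact_mod_cast hs)

theorem primeLog_nonneg (n : ℕ) : 0 ≤ primeLog n := by
  unfold primeLog; split_ifs
  · exact Real.log_natCast_nonneg n
  · rfl

theorem vonMangoldtRest_nonneg (n : ℕ) : 0 ≤ vonMangoldtRest n := by
  unfold vonMangoldtRest; split_ifs
  · rfl
  · exact ArithmeticFunction.vonMangoldt_nonneg

theorem primeLog_add_vonMangoldtRest (n : ℕ) :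
    primeLog n + vonMangoldtRest n = ArithmeticFunction.vonMangoldt n := by
  unfold primeLog vonMangoldtRest
  split_ifs with h
  · rw [ArithmeticFunction.vonMangoldt_apply_prime h, add_zero]
  · rw [zero_add]

theorem primeSqLog_mul_self (m : ℕ) : primeSqLog (m * m) = primeLog m := by
  simp [primeSqLog, Nat.sqrt_eq]

theorem primeSqLog_le (n : ℕ) : primeSqLog n ≤ vonMangoldtRest n := by
  by_cases h : IsSquare n
  · obtain ⟨m, rfl⟩ := h
    rw [primeSqLog_mul_self, vonMangoldtRest,
      if_neg fun h => h.prime.irreducible.not_isSquare ⟨m, rfl⟩, ← pow_two,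
      ArithmeticFunction.vonMangoldt_apply_pow two_ne_zero, ← primeLog_add_vonMangoldtRest]
    linarith [vonMangoldtRest_nonneg m]
  · simp only [primeSqLog, if_neg h]
    exact vonMangoldtRest_nonneg n

theorem sum_vonMangoldtRest (n : ℕ) :
    ∑ k ∈ Finset.Icc 1 n, vonMangoldtRest k = Chebyshev.psi n - Chebyshev.theta n := by
  rw [Chebyshev.psi_sub_theta_eq_sum_not_prime, Nat.floor_natCast, Finset.sum_filter]
  refine Finset.sum_congr (by ext; simp; omega) fun k _ => ?_
  unfold vonMangoldtRest
  split_ifs <;> rfl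

theorem sum_primeLog (n : ℕ) : ∑ k ∈ Finset.Icc 1 n, primeLog k = Chebyshev.theta n := by
  rw [Chebyshev.theta, Nat.floor_natCast, Finset.sum_filter]
  exact Finset.sum_congr (by ext; simp; omega) fun k _ => rfl

theorem sum_primeSqLog (n : ℕ) :
    ∑ k ∈ Finset.Icc 1 n, primeSqLog k = Chebyshev.theta n.sqrt := by
  rw [← sum_primeLog]
  symm
  have h : (Finset.Icc 1 n.sqrt).image (fun m => m * m) ⊆ Finset.Icc 1 n := by
    intro k hk
    obtain ⟨m, hm, rfl⟩ := Finset.mem_image.1 hk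
    rw [Finset.mem_Icc] at hm ⊢
    have := Nat.le_sqrt.1 hm.2
    exact ⟨by nlinarith, this⟩
  rw [← Finset.sum_subset h fun k hk hk' => ?_, Finset.sum_image]
  · exact Finset.sum_congr rfl fun m _ => (primeSqLog_mul_self m).symm
  · intro a _ b _ hab
    exact Nat.mul_self_inj.1 hab
  · rw [primeSqLog, if_neg]
    rintro ⟨m, rfl⟩
    apply hk'
    refine Finset.mem_image.2 ⟨m, ?_, rfl⟩
    rw [Finset.mem_Icc] at hk ⊢
    refine ⟨Nat.pos_of_ne_zero ?_, Nat.le_sqrt.2 hk.2⟩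
    rintro rfl
    simp at hk

theorem lSeriesSummable_vonMangoldtRest {s : ℂ} (hs : 1 / 2 < s.re) :
    LSeriesSummable (fun n => (vonMangoldtRest n : ℂ)) s := by
  obtain ⟨C, hC⟩ := Chebyshev.psi_sub_theta_le_mul_sqrt
  refine lSeriesSummable_of_sum_le vonMangoldtRest_nonneg (C := C) (by norm_num) (fun n => ?_) hs
  rw [sum_vonMangoldtRest, ← Real.sqrt_eq_rpow]
  exact hC n

theorem theta_sqrt (n : ℕ) : Chebyshev.theta n.sqrt = Chebyshev.theta (√(n : ℝ)) := by
  rw [Chebyshev.theta_eq_theta_coe_floor (√(n : ℝ)), Real.nat_floor_real_sqrt_eq_nat_sqrt]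

theorem lSeriesSummable_vonMangoldtRest_sub {s : ℂ} (hs : 1 / 3 < s.re) :
    LSeriesSummable (fun n => ((vonMangoldtRest n - primeSqLog n : ℝ) : ℂ)) s := by
  obtain ⟨C, hC⟩ := Chebyshev.psi_sub_theta_le_mul_sqrt
  set D := Real.log 4 + 4
  have hD : 0 ≤ D := by positivity
  refine lSeriesSummable_of_sum_le (fun n => sub_nonneg.2 (primeSqLog_le n))
    (C := |C| + D + D) (by norm_num) (fun n => ?_) hs
  rcases Nat.eq_zero_or_pos n with rfl | hn
  · simp
  have hn1 : (1 : ℝ) ≤ n := by exact_mod_cast hn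
  have hn0 : (0 : ℝ) ≤ n := by linarith
  rw [Finset.sum_sub_distrib, sum_vonMangoldtRest, sum_primeSqLog, theta_sqrt]
  have h1 := Chebyshev.psi_sub_theta_le_psi_add_psi_add_psi n
  have h2 := hC (√(n : ℝ))
  have h3 := Chebyshev.psi_le_const_mul_self (x := (n : ℝ) ^ (3 : ℝ)⁻¹) (by positivity)
  have h5 := Chebyshev.psi_le_const_mul_self (x := (n : ℝ) ^ (5 : ℝ)⁻¹) (by positivity)
  have e2 : (n : ℝ) ^ (2 : ℝ)⁻¹ = √(n : ℝ) := by rw [Real.sqrt_eq_rpow, one_div]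
  have h4 : √(√(n : ℝ)) ≤ (n : ℝ) ^ (1 / 3 : ℝ) := by
    rw [Real.sqrt_eq_rpow, Real.sqrt_eq_rpow, ← Real.rpow_mul hn0]
    exact Real.rpow_le_rpow_of_exponent_le hn1 (by norm_num)
  have h6 : (n : ℝ) ^ (5 : ℝ)⁻¹ ≤ (n : ℝ) ^ (1 / 3 : ℝ) :=
    Real.rpow_le_rpow_of_exponent_le hn1 (by norm_num)
  have h7 : C * √(√(n : ℝ)) ≤ |C| * (n : ℝ) ^ (1 / 3 : ℝ) :=
    mul_le_mul (le_abs_self C) h4 (Real.sqrt_nonneg _) (abs_nonneg C)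
  have h8 : D * (n : ℝ) ^ (5 : ℝ)⁻¹ ≤ D * (n : ℝ) ^ (1 / 3 : ℝ) :=
    mul_le_mul_of_nonneg_left h6 hD
  rw [e2] at h1
  rw [show (3 : ℝ)⁻¹ = 1 / 3 by norm_num] at h1 h3
  linarith

theorem lSeriesSummable_primeLog {s : ℂ} (hs : 1 < s.re) :
    LSeriesSummable (fun n => (primeLog n : ℂ)) s := by
  refine lSeriesSummable_of_sum_le primeLog_nonneg (C := Real.log 4) zero_le_one (fun n => ?_) hs
  rw [sum_primeLog, Real.rpow_one]
  exact Chebyshev.theta_le_log4_mul_x (by positivity)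

theorem lSeries_primeLog {s : ℂ} (hs : 1 < s.re) :
    LSeries (fun n => (primeLog n : ℂ)) s =
      -deriv riemannZeta s / riemannZeta s - LSeries (fun n => (vonMangoldtRest n : ℂ)) s := by
  rw [← ArithmeticFunction.LSeries_vonMangoldt_eq_deriv_riemannZeta_div hs, eq_sub_iff_add_eq,
    ← LSeries_add (lSeriesSummable_primeLog hs) (lSeriesSummable_vonMangoldtRest (by linarith))]
  congr 1
  ext n
  rw [← primeLog_add_vonMangoldtRest]
  simp

theorem term_primeSqLog (s : ℂ) (m : ℕ) :
    LSeries.term (fun n => (primeSqLog n : ℂ)) s (m * m) =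
      LSeries.term (fun n => (primeLog n : ℂ)) (2 * s) m := by
  rcases eq_or_ne m 0 with rfl | hm
  · simp
  rw [LSeries.term_of_ne_zero (by positivity), LSeries.term_of_ne_zero hm, primeSqLog_mul_self]
  have : (m : ℂ) ≠ 0 := by exact_mod_cast hm
  rw [two_mul s, Complex.cpow_add _ _ this, Nat.cast_mul, Complex.natCast_mul_natCast_cpow]

theorem support_term_primeSqLog (s : ℂ) :
    Function.support (LSeries.term (fun n => (primeSqLog n : ℂ)) s) ⊆
      Set.range fun m : ℕ => m * m := by
  intro n hn
  by_contra h
  refine hn ?_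
  have : ¬ IsSquare n := fun ⟨m, hm⟩ => h ⟨m, hm.symm⟩
  simp [LSeries.term, primeSqLog, this]

theorem lSeries_primeSqLog (s : ℂ) :
    LSeries (fun n => (primeSqLog n : ℂ)) s = LSeries (fun n => (primeLog n : ℂ)) (2 * s) := by
  have hinj : Function.Injective fun m : ℕ => m * m := fun a b hab => Nat.mul_self_inj.1 hab
  rw [LSeries, LSeries, ← hinj.tsum_eq (support_term_primeSqLog s)]
  exact tsum_congr fun m => term_primeSqLog s m

theorem lSeriesSummable_primeSqLog {s : ℂ} (hs : 1 / 2 < s.re) :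
    LSeriesSummable (fun n => (primeSqLog n : ℂ)) s := by
  have hinj : Function.Injective fun m : ℕ => m * m := fun a b hab => Nat.mul_self_inj.1 hab
  rw [LSeriesSummable, ← hinj.summable_iff fun n hn => by_contra fun h =>
    hn (support_term_primeSqLog s h)]
  refine (lSeriesSummable_primeLog (s := 2 * s) (by simp; linarith)).congr fun m => ?_
  exact (term_primeSqLog s m).symm

/-- The Dirichlet series of the von Mangoldt function off the primes. -/
noncomputable def primePowerSeries (s : ℂ) : ℂ := LSeries (fun n => (vonMangoldtRest n : ℂ)) s

theorem differentiableOn_primePowerSeries :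
    DifferentiableOn ℂ primePowerSeries {s | 1 / 2 < s.re} :=
  differentiableOn_lSeries_of_summable fun _ hs => lSeriesSummable_vonMangoldtRest hs

theorem primePowerSeries_eq {s : ℂ} (hs : 1 / 2 < s.re) :
    primePowerSeries s = -deriv riemannZeta (2 * s) / riemannZeta (2 * s) -
      primePowerSeries (2 * s) +
      LSeries (fun n => ((vonMangoldtRest n - primeSqLog n : ℝ) : ℂ)) s := by
  have h2 : 1 < (2 * s).re := by simp; linarith
  rw [primePowerSeries, primePowerSeries, ← lSeries_primeLog h2, ← lSeries_primeSqLog,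
    ← LSeries_add (lSeriesSummable_primeSqLog hs)
      (lSeriesSummable_vonMangoldtRest_sub (by linarith))]
  congr 1
  ext n
  simp

/-- The behaviour of the prime power series on approach to the line `Re s = 1/2`. -/
theorem tendsto_mul_primePowerSeries (l : ℝ) :
    Tendsto (fun σ : ℝ => (σ : ℂ) * primePowerSeries (1 / 2 + σ + l * Complex.I)) (𝓝[>] 0)
      (𝓝 (if l = 0 then 1 / 2 else 0)) := by
  have hc : ContinuousAt (fun s : ℂ => -(deriv zetaMul (2 * s) / zetaMul (2 * s)) -
      primePowerSeries (2 * s) +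
      LSeries (fun n => ((vonMangoldtRest n - primeSqLog n : ℝ) : ℂ)) s)
      (1 / 2 + l * Complex.I) := by
    have hre : (2 * (1 / 2 + l * Complex.I) : ℂ).re = 1 := by simp
    have h1 : ContinuousAt primePowerSeries (2 * (1 / 2 + l * Complex.I)) :=
      (differentiableOn_primePowerSeries.differentiableAt
        ((isOpen_re_gt _).mem_nhds (by rw [mem_ofPred_eq, hre]; norm_num))).continuousAt
    have h2 : ContinuousAt (LSeries (fun n => ((vonMangoldtRest n - primeSqLog n : ℝ) : ℂ)))
        (1 / 2 + l * Complex.I) :=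
      ((differentiableOn_lSeries_of_summable fun s hs =>
        lSeriesSummable_vonMangoldtRest_sub hs).differentiableAt
        ((isOpen_re_gt (1 / 3)).mem_nhds (by simp; norm_num))).continuousAt
    have h3 : ContinuousAt (fun s : ℂ => 2 * s) (1 / 2 + l * Complex.I) := by fun_prop
    have h4 : Continuous (deriv zetaMul) :=
      (differentiable_zetaMul.contDiff (n := 1)).continuous_deriv le_rfl
    have h5 := differentiable_zetaMul.continuous
    refine ContinuousAt.add (ContinuousAt.sub (ContinuousAt.neg (ContinuousAt.div ?_ ?_ ?_)) ?_) h2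
    · fun_prop
    · fun_prop
    · exact zetaMul_ne_zero_of_one_le_re hre.ge
    · exact ContinuousAt.comp (f := fun s : ℂ => 2 * s) h1 h3
  have hσ : Tendsto (fun σ : ℝ => (1 / 2 + σ + l * Complex.I : ℂ)) (𝓝[>] 0)
      (𝓝 (1 / 2 + l * Complex.I)) := by
    have : Continuous fun σ : ℝ => (1 / 2 + σ + l * Complex.I : ℂ) := by fun_prop
    have := this.tendsto 0
    simp only [Complex.ofReal_zero, add_zero] at this
    exact this.mono_left nhdsWithin_le_nhds
  have h0 : Tendsto (fun σ : ℝ => (σ : ℂ)) (𝓝[>] 0) (𝓝 0) := by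
    have := Complex.continuous_ofReal.tendsto 0
    exact this.mono_left nhdsWithin_le_nhds
  have hA := h0.mul (hc.tendsto.comp hσ)
  rw [zero_mul] at hA
  have hB : Tendsto (fun σ : ℝ => (σ : ℂ) * (1 / (2 * σ + 2 * l * Complex.I))) (𝓝[>] 0)
      (𝓝 (if l = 0 then 1 / 2 else 0)) := by
    split_ifs with hl
    · refine Tendsto.congr' ?_ tendsto_const_nhds
      filter_upwards [self_mem_nhdsWithin] with σ hσ
      have : (σ : ℂ) ≠ 0 := by exact_mod_cast (ne_of_gt hσ)
      simp only [hl, Complex.ofReal_zero, mul_zero, zero_mul, add_zero]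
      field_simp
    · have : ContinuousAt (fun σ : ℝ => (σ : ℂ) * (1 / (2 * σ + 2 * l * Complex.I))) 0 := by
        refine ContinuousAt.mul (by fun_prop) (ContinuousAt.div (by fun_prop) (by fun_prop) ?_)
        simp [hl]
      have := this.tendsto
      simp only [Complex.ofReal_zero, zero_mul] at this
      exact this.mono_left nhdsWithin_le_nhds
  have hAB := hB.add hA
  rw [add_zero] at hAB
  refine hAB.congr' ?_
  filter_upwards [self_mem_nhdsWithin] with σ hσ
  have hσ0 : 0 < σ := hσ
  have hre : (1 / 2 + σ + l * Complex.I : ℂ).re = 1 / 2 + σ := by simp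
  have hre2 : (2 * (1 / 2 + σ + l * Complex.I) : ℂ).re = 1 + 2 * σ := by simp; ring
  have hne : (2 * (1 / 2 + σ + l * Complex.I) : ℂ) ≠ 1 := by
    intro h
    have := congrArg Complex.re h
    rw [hre2] at this
    simp at this
    linarith
  rw [primePowerSeries_eq (by rw [hre]; linarith)]
  simp only [Function.comp_apply]
  rw [deriv_zetaMul_div hne (riemannZeta_ne_zero_of_one_le_re (by rw [hre2]; linarith))]
  rw [show (2 * (1 / 2 + σ + l * Complex.I) - 1 : ℂ) = 2 * σ + 2 * l * Complex.I by ring]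
  ring

end LittlewoodPi

namespace LittlewoodPi

open Set Metric Filter Topology

theorem analyticOrderAt_ne_top_of_entire {f : ℂ → ℂ} (hf : Differentiable ℂ f) {w₀ : ℂ}
    (h0 : f w₀ ≠ 0) (w : ℂ) : analyticOrderAt f w ≠ ⊤ := by
  have hfa : AnalyticOnNhd ℂ f univ := fun z _ => hf.analyticAt z
  refine hfa.analyticOrderAt_ne_top_of_isPreconnected isPreconnected_univ (mem_univ w₀)
    (mem_univ w) ?_
  rw [(hf.analyticAt w₀).analyticOrderAt_eq_zero.2 h0]
  simp

/-- An entire function is divisible by the full power of `z - w` at a zero `w`. -/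
theorem exists_eq_sub_pow_mul {f : ℂ → ℂ} (hf : Differentiable ℂ f) {w₀ : ℂ} (h0 : f w₀ ≠ 0)
    (w : ℂ) : ∃ g : ℂ → ℂ, Differentiable ℂ g ∧ g w ≠ 0 ∧
      ∀ z, f z = (z - w) ^ analyticOrderNatAt f w * g z := by
  set n := analyticOrderNatAt f w with hn
  have hord := Nat.cast_analyticOrderNatAt (analyticOrderAt_ne_top_of_entire hf h0 w)
  obtain ⟨g, hga, hgw, hg⟩ := ((hf.analyticAt w).analyticOrderAt_eq_natCast (n := n)).1 hord.symm
  have hne (z : ℂ) (hz : z ≠ w) : Function.update (fun z => f z / (z - w) ^ n) w (g w) z =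
      f z / (z - w) ^ n := by simp [hz]
  have hev : Function.update (fun z => f z / (z - w) ^ n) w (g w) =ᶠ[𝓝 w] g := by
    filter_upwards [hg] with z hz
    by_cases h : z = w
    · subst h; simp
    · have : z - w ≠ 0 := sub_ne_zero.2 h
      rw [hne z h, hz, smul_eq_mul]
      field_simp
  refine ⟨Function.update (fun z => f z / (z - w) ^ n) w (g w), fun z => ?_, by simpa using hgw,
    fun z => ?_⟩
  · by_cases h : z = w
    · subst h
      exact hga.differentiableAt.congr_of_eventuallyEq hev
    · have : (z - w) ^ n ≠ 0 := pow_ne_zero _ (sub_ne_zero.2 h)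
      have hd : DifferentiableAt ℂ (fun z => f z / (z - w) ^ n) z :=
        (hf z).div (by fun_prop) this
      refine hd.congr_of_eventuallyEq ?_
      filter_upwards [isOpen_ne.mem_nhds h] with y hy using hne y hy
  · by_cases h : z = w
    · subst h
      rw [Function.update_self]
      exact hg.self_of_nhds
    · have : z - w ≠ 0 := sub_ne_zero.2 h
      rw [hne z h]
      field_simp

/-- Removal of finitely many zeros from an entire function. -/
theorem exists_eq_prod_sub_pow_mul {f : ℂ → ℂ} (hf : Differentiable ℂ f) {w₀ : ℂ} (h0 : f w₀ ≠ 0)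
    (s : Finset ℂ) : ∃ g : ℂ → ℂ, Differentiable ℂ g ∧ (∀ w ∈ s, g w ≠ 0) ∧
      ∀ z, f z = (∏ w ∈ s, (z - w) ^ analyticOrderNatAt f w) * g z := by
  classical
  induction s using Finset.induction_on with
  | empty => exact ⟨f, hf, by simp, by simp⟩
  | insert w s hw ih =>
    obtain ⟨g, hg, hgs, hfg⟩ := ih
    have hgw₀ : g w₀ ≠ 0 := fun h => h0 (by rw [hfg, h, mul_zero])
    obtain ⟨g', hg', hg'w, hgg'⟩ := exists_eq_sub_pow_mul hg hgw₀ w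
    have hord : analyticOrderAt f w = analyticOrderAt g w := by
      have hP : Differentiable ℂ fun z => ∏ w ∈ s, (z - w) ^ analyticOrderNatAt f w := by fun_prop
      have hP0 : ∏ w' ∈ s, (w - w') ^ analyticOrderNatAt f w' ≠ 0 :=
        Finset.prod_ne_zero_iff.2 fun w' hw' =>
          pow_ne_zero _ (sub_ne_zero.2 fun h => hw (h ▸ hw'))
      have : f = (fun z => ∏ w ∈ s, (z - w) ^ analyticOrderNatAt f w) * g := funext hfg
      conv_lhs => rw [this]
      rw [analyticOrderAt_mul (hP.analyticAt w) (hg.analyticAt w),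
        (hP.analyticAt w).analyticOrderAt_eq_zero.2 hP0, zero_add]
    have hord' : analyticOrderNatAt f w = analyticOrderNatAt g w := by
      rw [analyticOrderNatAt, hord, analyticOrderNatAt]
    refine ⟨g', hg', fun w' hw' => ?_, fun z => ?_⟩
    · rcases Finset.mem_insert.1 hw' with rfl | hw'
      · exact hg'w
      · intro h
        exact hgs w' hw' (by rw [hgg', h, mul_zero])
    · rw [hfg, hgg', Finset.prod_insert hw, hord']
      ring

theorem finite_zeros_closedBall {f : ℂ → ℂ} (hf : Differentiable ℂ f) {w₀ : ℂ} (h0 : f w₀ ≠ 0)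
    (R : ℝ) : {z | z ∈ closedBall (0 : ℂ) R ∧ f z = 0}.Finite := by
  by_contra hinf
  obtain ⟨x, -, hx⟩ := Set.Infinite.exists_accPt_of_subset_isCompact hinf
    (isCompact_closedBall (0 : ℂ) R) fun z hz => hz.1
  rw [accPt_iff_frequently] at hx
  have hfa : AnalyticOnNhd ℂ f univ := fun z _ => hf.analyticAt z
  refine h0 (hfa.eqOn_zero_of_preconnected_of_frequently_eq_zero isPreconnected_univ (mem_univ x)
    ?_ (mem_univ w₀))
  rw [frequently_nhdsWithin_iff]
  exact hx.mono fun y hy => ⟨hy.2.2, hy.1⟩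

/-- A zero-free holomorphic function on a disc has a logarithm. -/
theorem exists_log_on_ball {g : ℂ → ℂ} {R : ℝ} (hR : 0 < R) (hg : DifferentiableOn ℂ g (ball 0 R))
    (h0 : ∀ z ∈ ball (0 : ℂ) R, g z ≠ 0) :
    ∃ l : ℂ → ℂ, DifferentiableOn ℂ l (ball 0 R) ∧ l 0 = 0 ∧
      ∀ z ∈ ball (0 : ℂ) R, g z = g 0 * Complex.exp (l z) := by
  have hd : DifferentiableOn ℂ (fun z => deriv g z / g z) (ball 0 R) :=
    (hg.deriv isOpen_ball).div hg h0
  obtain ⟨k, hk⟩ := hd.isExactOn_ball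
  have hkd : DifferentiableOn ℂ k (ball 0 R) := fun z hz =>
    (hk z hz).differentiableAt.differentiableWithinAt
  refine ⟨fun z => k z - k 0, by fun_prop, by simp, fun z hz => ?_⟩
  have hder (y : ℂ) (hy : y ∈ ball (0 : ℂ) R) :
      HasDerivAt (fun z => g z * Complex.exp (-k z)) 0 y := by
    have h1 : HasDerivAt g (deriv g y) y :=
      (hg.differentiableAt (isOpen_ball.mem_nhds hy)).hasDerivAt
    refine (h1.mul (hk y hy).neg.cexp).congr_deriv ?_
    have e : g y * (deriv g y / g y) = deriv g y := mul_div_cancel₀ _ (h0 y hy)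
    linear_combination -Complex.exp ((-k) y) * e
  have hconst : g z * Complex.exp (-k z) = g 0 * Complex.exp (-k 0) :=
    isOpen_ball.is_const_of_deriv_eq_zero (convex_ball (0 : ℂ) R).isPreconnected
      (fun y hy => (hder y hy).differentiableAt.differentiableWithinAt)
      (fun y hy => (hder y hy).deriv) hz (mem_ball_self hR)
  change g z = g 0 * Complex.exp (k z - k 0)
  rw [sub_eq_add_neg, Complex.exp_add, mul_left_comm, ← hconst, mul_left_comm, ← Complex.exp_add]
  simp

/-- A Schwarz lemma for functions vanishing to second order. -/
theorem norm_le_of_even {e : ℂ → ℂ} {r E : ℝ} (hr : 0 < r) (he : DifferentiableOn ℂ e (ball 0 r))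
    (h0 : e 0 = 0) (heven : ∀ z, e (-z) = e z) (hE : ∀ z ∈ ball (0 : ℂ) r, ‖e z‖ ≤ E) {a : ℂ}
    (ha : ‖a‖ < r / 2) : ‖e a‖ ≤ E * (2 * ‖a‖ / r) ^ 2 := by
  have hnhds : ball (0 : ℂ) r ∈ 𝓝 0 := ball_mem_nhds _ hr
  have hd0 : deriv e 0 = 0 := by
    have h1 : (fun z => e (-z)) = e := funext heven
    have h2 := deriv_comp_neg e 0
    rw [h1, neg_zero] at h2
    exact CharZero.eq_neg_self_iff.1 h2
  set e₁ := dslope e 0 with he₁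
  set e₂ := dslope e₁ 0 with he₂
  have hd₁ : DifferentiableOn ℂ e₁ (ball 0 r) := (Complex.differentiableOn_dslope hnhds).2 he
  have hd₂ : DifferentiableOn ℂ e₂ (ball 0 r) := (Complex.differentiableOn_dslope hnhds).2 hd₁
  have h₁ (z : ℂ) : e z = z * e₁ z := by
    have := sub_smul_dslope e 0 z
    rw [h0, sub_zero, sub_zero, smul_eq_mul] at this
    exact this.symm
  have h₂ (z : ℂ) : e₁ z = z * e₂ z := by
    have := sub_smul_dslope e₁ 0 z
    rw [he₁, dslope_same, hd0, ← he₁, sub_zero, sub_zero, smul_eq_mul] at this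
    exact this.symm
  have hcl : closedBall (0 : ℂ) (r / 2) ⊆ ball 0 r := closedBall_subset_ball (by linarith)
  have hmax : ‖e₂ a‖ ≤ E / (r / 2) ^ 2 := by
    refine Complex.norm_le_of_forall_mem_frontier_norm_le (U := ball (0 : ℂ) (r / 2)) isBounded_ball
      ?_ ?_ (subset_closure (by simpa using ha))
    · refine DifferentiableOn.diffContOnCl ?_
      rw [closure_ball _ (by positivity)]
      exact hd₂.mono hcl
    · intro z hz
      rw [frontier_ball _ (by positivity)] at hz
      have hz' : ‖z‖ = r / 2 := by simpa using hz
      have := hE z (hcl (sphere_subset_closedBall hz))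
      rw [h₁, h₂, norm_mul, norm_mul, hz'] at this
      rw [le_div_iff₀ (by positivity)]
      linarith
  rw [h₁, h₂, norm_mul, norm_mul]
  calc ‖a‖ * (‖a‖ * ‖e₂ a‖) ≤ ‖a‖ * (‖a‖ * (E / (r / 2) ^ 2)) := by gcongr
    _ = E * (2 * ‖a‖ / r) ^ 2 := by field_simp

theorem norm_sq_le_of_sum_log_le_aux {f : ℂ → ℂ} (hf : Differentiable ℂ f)
    (heven : ∀ z, f (-z) = f z) (h0 : f 0 ≠ 0) {C : ℝ}
    (hgrowth : ∀ R : ℝ, 1 ≤ R → ∀ z, ‖z‖ ≤ R → ‖f z‖ ≤ Real.exp (C * R ^ (3 / 2 : ℝ)))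
    (hre : ∀ z, f z = 0 → z.re = 0) {a : ℝ} (ha : 0 < a) {B : ℝ}
    (hB : ∀ s : Finset ℂ, (∀ w ∈ s, f w = 0) →
      ∑ w ∈ s, analyticOrderNatAt f w * Real.log (1 + a ^ 2 / w.im ^ 2) ≤ B) {R : ℝ} (hR : 1 ≤ R)
    (haR : 4 * a < R) :
    ‖f a‖ ^ 2 ≤ ‖f 0‖ ^ 2 * Real.exp (B +
      4 * (|C| * (2 * R) ^ (3 / 2 : ℝ) + |Real.log ‖f 0‖| + 1) * (4 * a / R) ^ 2) := by
  set M := |C| * (2 * R) ^ (3 / 2 : ℝ) + |Real.log ‖f 0‖| + 1 with hM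
  have hM0 : 0 < M := by positivity
  have hR0 : 0 < R := by linarith
  set s := (finite_zeros_closedBall hf h0 R).toFinset with hs
  have hsz (w : ℂ) : w ∈ s ↔ ‖w‖ ≤ R ∧ f w = 0 := by simp [hs]
  have hw0 (w : ℂ) (hw : w ∈ s) : w ≠ 0 := by
    rintro rfl
    exact h0 ((hsz 0).1 hw).2
  obtain ⟨G, hG, hGs, hfG⟩ := exists_eq_prod_sub_pow_mul hf h0 s
  set m := analyticOrderNatAt f
  let P : ℂ → ℂ := fun z => ∏ w ∈ s, (1 - z / w) ^ m w
  let g : ℂ → ℂ := fun z => (∏ w ∈ s, (-w) ^ m w) * G z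
  have hg : Differentiable ℂ g := by fun_prop
  have hfg (z : ℂ) : f z = P z * g z := by
    simp only [P, g]
    rw [hfG, ← mul_assoc, ← Finset.prod_mul_distrib]
    congr 1
    refine Finset.prod_congr rfl fun w hw => ?_
    rw [← mul_pow]
    congr 1
    have := hw0 w hw
    field_simp
    ring
  have hg0 : g 0 = f 0 := by rw [hfg]; simp [P]
  have hgne (z : ℂ) (hz : ‖z‖ ≤ R) : g z ≠ 0 := by
    refine mul_ne_zero (Finset.prod_ne_zero_iff.2 fun w hw =>
      pow_ne_zero _ (neg_ne_zero.2 (hw0 w hw))) ?_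
    by_cases hzs : z ∈ s
    · exact hGs z hzs
    · intro h
      exact hzs ((hsz z).2 ⟨hz, by rw [hfG, h, mul_zero]⟩)
  have hgbd (z : ℂ) (hz : ‖z‖ < R) : ‖g z‖ ≤ Real.exp (|C| * (2 * R) ^ (3 / 2 : ℝ)) := by
    refine Complex.norm_le_of_forall_mem_frontier_norm_le (U := ball (0 : ℂ) (2 * R)) isBounded_ball
      hg.diffContOnCl ?_ (subset_closure (by simp; linarith))
    intro y hy
    rw [frontier_ball _ (by positivity)] at hy
    have hy' : ‖y‖ = 2 * R := by simpa using hy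
    have hPy : 1 ≤ ‖P y‖ := by
      simp only [P, norm_prod, norm_pow]
      refine Finset.prod_induction _ (1 ≤ ·) (fun _ _ => one_le_mul_of_one_le_of_one_le) le_rfl
        fun w hw => one_le_pow₀ ?_
      have h1 : 2 ≤ ‖y / w‖ := by
        rw [norm_div, hy', le_div_iff₀ (norm_pos_iff.2 (hw0 w hw))]
        linarith [((hsz w).1 hw).1]
      have h2 := norm_sub_norm_le (y / w) 1
      rw [norm_one, norm_sub_rev] at h2
      linarith
    calc ‖g y‖ ≤ ‖P y‖ * ‖g y‖ := le_mul_of_one_le_left (norm_nonneg _) hPy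
      _ = ‖f y‖ := by rw [hfg]; exact (norm_mul _ _).symm
      _ ≤ Real.exp (C * (2 * R) ^ (3 / 2 : ℝ)) := hgrowth (2 * R) (by linarith) y hy'.le
      _ ≤ _ := Real.exp_le_exp.2 (mul_le_mul_of_nonneg_right (le_abs_self C) (by positivity))
  obtain ⟨l, hl, hl0, hgl⟩ := exists_log_on_ball hR0 (hg.differentiableOn (s := ball 0 R))
    fun z hz => hgne z (by simpa using (mem_ball_zero_iff.1 hz).le)
  have hf0 : 0 < ‖f 0‖ := norm_pos_iff.2 h0
  have hlre (z : ℂ) (hz : z ∈ ball (0 : ℂ) R) : (l z).re ≤ M := by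
    have h1 := hgbd z (by simpa using hz)
    rw [hgl z hz, norm_mul, Complex.norm_exp, hg0] at h1
    have h2 := Real.log_le_log (by positivity) h1
    rw [Real.log_mul hf0.ne' (Real.exp_pos _).ne', Real.log_exp, Real.log_exp] at h2
    linarith [neg_abs_le (Real.log ‖f 0‖)]
  have hlbd (z : ℂ) (hz : z ∈ ball (0 : ℂ) (R / 2)) : ‖l z‖ ≤ 2 * M := by
    have hz' : ‖z‖ < R / 2 := by simpa using hz
    refine (Complex.borelCaratheodory_zero hM0 hl hlre hR0
      (ball_subset_ball (by linarith) hz) hl0).trans ?_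
    rw [div_le_iff₀ (by linarith)]
    nlinarith
  have heven' : ‖l a + l (-a)‖ ≤ 4 * M * (4 * a / R) ^ 2 := by
    have hsub : ball (0 : ℂ) (R / 2) ⊆ ball 0 R := ball_subset_ball (by linarith)
    have hneg : MapsTo (fun z : ℂ => -z) (ball 0 (R / 2)) (ball 0 R) := fun z hz =>
      hsub (by simpa using hz)
    have := norm_le_of_even (e := fun z => l z + l (-z)) (r := R / 2) (E := 4 * M) (a := a)
      (by linarith) ((hl.mono hsub).add (hl.comp (by fun_prop) hneg)) (by simp [hl0])
      (fun z => by simp [add_comm]) (fun z hz => ?_) ?_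
    · refine this.trans_eq ?_
      rw [Complex.norm_real, Real.norm_eq_abs, abs_of_pos ha]
      ring
    · refine (norm_add_le _ _).trans ?_
      linarith [hlbd z hz, hlbd (-z) (by simpa using hz)]
    · rw [Complex.norm_real, Real.norm_eq_abs, abs_of_pos ha]
      linarith
  have hPP : ‖P a * P (-a)‖ ≤ Real.exp B := by
    have h1 : ‖P a * P (-a)‖ = ∏ w ∈ s, (1 + a ^ 2 / w.im ^ 2) ^ m w := by
      simp only [P]
      rw [← Finset.prod_mul_distrib, norm_prod]
      refine Finset.prod_congr rfl fun w hw => ?_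
      rw [← mul_pow, norm_pow]
      congr 1
      have hwre := hre w ((hsz w).1 hw).2
      have hw : w = w.im * Complex.I := by
        conv_lhs => rw [← Complex.re_add_im w, hwre]
        simp
      have hwim : w.im ≠ 0 := by
        intro h
        rw [h] at hw
        exact hw0 w ‹_› (by simpa using hw)
      have h2 : (1 - (a : ℂ) / w) * (1 - -(a : ℂ) / w) = ((1 + a ^ 2 / w.im ^ 2 : ℝ) : ℂ) := by
        have h3 : (1 - (a : ℂ) / w) * (1 - -(a : ℂ) / w) = 1 - (a : ℂ) ^ 2 / w ^ 2 := by ring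
        rw [h3]
        conv_lhs => rw [hw, mul_pow, Complex.I_sq]
        push_cast
        ring
      rw [h2, Complex.norm_real, Real.norm_eq_abs, abs_of_pos (by positivity)]
    rw [h1, ← Real.log_le_iff_le_exp (Finset.prod_pos fun w _ => by positivity), Real.log_prod
      fun w _ => by positivity]
    refine le_trans (le_of_eq (Finset.sum_congr rfl fun w _ => ?_))
      (hB s fun w hw => ((hsz w).1 hw).2)
    rw [Real.log_pow]
  have haball (b : ℂ) (hb : ‖b‖ = a) : b ∈ ball (0 : ℂ) R := by
    rw [mem_ball_zero_iff, hb]; linarith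
  have hna : ‖(a : ℂ)‖ = a := by rw [Complex.norm_real, Real.norm_eq_abs, abs_of_pos ha]
  have hfin : f a * f (-a) = (P a * P (-a)) * f 0 ^ 2 * Complex.exp (l a + l (-a)) := by
    rw [hfg a, hfg (-a), hgl a (haball a hna), hgl (-a) (haball (-a) (by rwa [norm_neg])), hg0,
      Complex.exp_add]
    ring
  rw [heven, ← pow_two] at hfin
  rw [← norm_pow, hfin, norm_mul, norm_mul, norm_pow, Complex.norm_exp, Real.exp_add]
  calc ‖P a * P (-a)‖ * ‖f 0‖ ^ 2 * Real.exp (l a + l (-a)).re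
      ≤ Real.exp B * ‖f 0‖ ^ 2 * Real.exp (4 * M * (4 * a / R) ^ 2) := by
        gcongr
        exact (Complex.re_le_norm _).trans heven'
    _ = _ := by ring

/-- An even entire function of order less than `2` with purely imaginary zeros is bounded on the
real axis in terms of its zeros. -/
theorem norm_sq_le_of_sum_log_le {f : ℂ → ℂ} (hf : Differentiable ℂ f)
    (heven : ∀ z, f (-z) = f z) (h0 : f 0 ≠ 0) {C : ℝ}
    (hgrowth : ∀ R : ℝ, 1 ≤ R → ∀ z, ‖z‖ ≤ R → ‖f z‖ ≤ Real.exp (C * R ^ (3 / 2 : ℝ)))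
    (hre : ∀ z, f z = 0 → z.re = 0) {a : ℝ} (ha : 0 < a) {B : ℝ}
    (hB : ∀ s : Finset ℂ, (∀ w ∈ s, f w = 0) →
      ∑ w ∈ s, analyticOrderNatAt f w * Real.log (1 + a ^ 2 / w.im ^ 2) ≤ B) :
    ‖f a‖ ^ 2 ≤ ‖f 0‖ ^ 2 * Real.exp B := by
  have hlim : Tendsto (fun R : ℝ => ‖f 0‖ ^ 2 * Real.exp (B +
      4 * (|C| * (2 * R) ^ (3 / 2 : ℝ) + |Real.log ‖f 0‖| + 1) * (4 * a / R) ^ 2)) atTop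
      (𝓝 (‖f 0‖ ^ 2 * Real.exp (B + 0))) := by
    refine ((Real.continuous_exp.tendsto _).comp (tendsto_const_nhds.add ?_)).const_mul _
    have h1 : Tendsto (fun R : ℝ => R ^ (-(1 / 2) : ℝ)) atTop (𝓝 0) :=
      tendsto_rpow_neg_atTop (by norm_num)
    have h2 : Tendsto (fun R : ℝ => R ^ (-2 : ℝ)) atTop (𝓝 0) :=
      tendsto_rpow_neg_atTop (by norm_num)
    have h3 := (h1.const_mul (64 * a ^ 2 * |C| * 2 ^ (3 / 2 : ℝ))).add
      (h2.const_mul (64 * a ^ 2 * (|Real.log ‖f 0‖| + 1)))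
    rw [mul_zero, mul_zero, add_zero] at h3
    refine h3.congr' ?_
    filter_upwards [eventually_gt_atTop 0] with R hR
    rw [Real.mul_rpow (by norm_num) hR.le, show (-(1 / 2) : ℝ) = 3 / 2 + -2 by norm_num,
      Real.rpow_add hR, Real.rpow_neg hR.le, Real.rpow_two]
    field_simp
    ring
  rw [add_zero] at hlim
  refine ge_of_tendsto hlim ?_
  filter_upwards [eventually_ge_atTop 1, eventually_gt_atTop (4 * a)] with R h1 h2
  exact norm_sq_le_of_sum_log_le_aux hf heven h0 hgrowth hre ha hB h1 h2

end LittlewoodPi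

namespace LittlewoodPi

open Set Filter Topology

/-- The combinations of elements of `Γ` with coefficients in `{0, …, N - 1}`. -/
noncomputable def boxSums (Γ : Finset ℝ) (N : ℕ) : Finset ℝ :=
  (Fintype.piFinset fun _ : Γ => Finset.range N).image
    fun k : Γ → ℕ => ∑ γ : Γ, (k γ : ℝ) * (γ : ℝ)

theorem card_boxSums_le (Γ : Finset ℝ) (N : ℕ) : (boxSums Γ N).card ≤ N ^ Γ.card := by
  refine Finset.card_image_le.trans ?_
  simp

theorem boxSums_nonempty (Γ : Finset ℝ) {N : ℕ} (hN : 0 < N) : (boxSums Γ N).Nonempty := by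
  refine Finset.Nonempty.image ⟨fun _ => 0, ?_⟩ _
  simpa [Fintype.mem_piFinset] using fun _ _ => hN

theorem boxSums_mono (Γ : Finset ℝ) (N : ℕ) : boxSums Γ N ⊆ boxSums Γ (N + 1) :=
  Finset.image_subset_image (Fintype.piFinset_subset _ _ fun _ => by simp)

theorem add_mem_boxSums {Γ : Finset ℝ} {N : ℕ} {β γ : ℝ} (hβ : β ∈ boxSums Γ N) (hγ : γ ∈ Γ) :
    β + γ ∈ boxSums Γ (N + 1) := by
  classical
  obtain ⟨k, hk, rfl⟩ := Finset.mem_image.1 hβ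
  rw [Fintype.mem_piFinset] at hk
  refine Finset.mem_image.2 ⟨fun g => k g + if g = ⟨γ, hγ⟩ then 1 else 0, ?_, ?_⟩
  · rw [Fintype.mem_piFinset]
    intro g
    have := Finset.mem_range.1 (hk g)
    rw [Finset.mem_range]
    split_ifs <;> omega
  · push_cast
    simp [add_mul, Finset.sum_add_distrib]

/-- Boxes grow slowly along a subsequence. -/
theorem exists_card_boxSums_succ_le (Γ : Finset ℝ) {η : ℝ} (hη : 0 < η) :
    ∃ N, 0 < N ∧ ((boxSums Γ (N + 1)).card : ℝ) ≤ (1 + η) * (boxSums Γ N).card := by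
  by_contra! hcon
  have hgrow (N : ℕ) : (1 + η) ^ N ≤ (boxSums Γ (N + 1)).card := by
    induction N with
    | zero =>
      simp only [pow_zero, zero_add]
      exact_mod_cast (boxSums_nonempty Γ one_pos).card_pos
    | succ N ih =>
      rw [pow_succ']
      exact (mul_le_mul_of_nonneg_left ih (by linarith)).trans (hcon (N + 1) (by omega)).le
  have hlim := tendsto_pow_const_div_const_pow_of_one_lt Γ.card (r := 1 + η) (by linarith)
  have hlim' := (tendsto_add_atTop_iff_nat 1).2 hlim
  have hev := hlim'.eventually (gt_mem_nhds (show (0 : ℝ) < (1 + η)⁻¹ by positivity))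
  obtain ⟨N, hN⟩ := hev.exists
  have h1 := hgrow N
  have h2 : ((boxSums Γ (N + 1)).card : ℝ) ≤ ((N + 1 : ℕ) : ℝ) ^ Γ.card := by
    exact_mod_cast card_boxSums_le Γ (N + 1)
  rw [div_lt_iff₀ (by positivity), pow_succ', inv_mul_cancel_left₀ (by positivity)] at hN
  linarith

theorem card_filter_add_mem_ge {Γ : Finset ℝ} {N : ℕ} {γ : ℝ} (hγ : γ ∈ Γ) :
    2 * (boxSums Γ N).card ≤
      ((boxSums Γ N).filter fun β => β + γ ∈ boxSums Γ N).card + (boxSums Γ (N + 1)).card := by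
  classical
  set A := boxSums Γ N
  have h1 := Finset.card_filter_add_card_filter_not (s := A) (fun β => β + γ ∈ A)
  have h2 : (A.filter fun β => ¬ (β + γ ∈ A)).card ≤ (boxSums Γ (N + 1) \ A).card := by
    refine Finset.card_le_card_of_injOn (fun β => β + γ) (fun β hβ => ?_)
      fun a _ b _ hab => add_right_cancel hab
    have hβ' := Finset.mem_filter.1 hβ
    exact Finset.mem_coe.2 (Finset.mem_sdiff.2 ⟨add_mem_boxSums hβ'.1 hγ, hβ'.2⟩)
  have h3 : (boxSums Γ (N + 1) \ A).card + A.card = (boxSums Γ (N + 1)).card :=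
    Finset.card_sdiff_add_card_eq_card (boxSums_mono Γ N)
  omega

/-- A positive-definite function on the reals which is nonpositive off a finite set `Γ ∪ {0}` has
nonnegative sum over that set. -/
theorem sum_nonneg_of_posDef {ψ : ℝ → ℝ} (hpos : ∀ A : Finset ℝ, 0 ≤ ∑ α ∈ A, ∑ β ∈ A, ψ (α - β))
    {Γ : Finset ℝ} (h0 : (0 : ℝ) ∉ Γ) (hneg : ∀ l, l ≠ 0 → l ∉ Γ → ψ l ≤ 0) :
    0 ≤ ψ 0 + ∑ γ ∈ Γ, ψ γ := by
  classical
  refine le_of_forall_pos_le_add fun ε hε => ?_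
  set T := ∑ γ ∈ Γ, |ψ γ|
  have hT : 0 ≤ T := Finset.sum_nonneg fun _ _ => abs_nonneg _
  set η := ε / (T + 1)
  have hη : 0 < η := by positivity
  have hηT : η * T ≤ ε := by
    rw [div_mul_eq_mul_div, div_le_iff₀ (by positivity)]
    nlinarith
  obtain ⟨N, hN, hcard⟩ := exists_card_boxSums_succ_le Γ hη
  set A := boxSums Γ N with hA
  have hA0 : (0 : ℝ) < A.card := by exact_mod_cast (boxSums_nonempty Γ hN).card_pos
  let c : ℝ → ℝ := fun l => ((A.filter fun β => β + l ∈ A).card : ℝ)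
  have hc (l : ℝ) : ∑ α ∈ A, ∑ β ∈ A, (if α - β = l then ψ l else 0) = c l * ψ l := by
    rw [Finset.sum_comm]
    simp only [c]
    rw [← nsmul_eq_mul, ← Finset.sum_const, Finset.sum_filter]
    refine Finset.sum_congr rfl fun β _ => ?_
    have : ∀ α, (α - β = l) ↔ (β + l = α) := fun α => by
      constructor <;> intro h <;> linarith
    simp only [this]
    rw [Finset.sum_ite_eq]
  have hle : ∑ α ∈ A, ∑ β ∈ A, ψ (α - β) ≤ c 0 * ψ 0 + ∑ γ ∈ Γ, c γ * ψ γ := by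
    calc ∑ α ∈ A, ∑ β ∈ A, ψ (α - β)
        ≤ ∑ α ∈ A, ∑ β ∈ A, ((if α - β = 0 then ψ 0 else 0) +
            ∑ γ ∈ Γ, if α - β = γ then ψ γ else 0) := by
          refine Finset.sum_le_sum fun α _ => Finset.sum_le_sum fun β _ => ?_
          rw [Finset.sum_ite_eq]
          by_cases hz : α - β = 0
          · rw [if_pos hz, hz, if_neg h0, add_zero]
          · rw [if_neg hz, zero_add]
            split_ifs with hg
            · rfl
            · exact hneg _ hz hg
      _ = c 0 * ψ 0 + ∑ γ ∈ Γ, c γ * ψ γ := by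
          simp only [Finset.sum_add_distrib, hc]
          congr 1
          rw [← Finset.sum_congr rfl fun γ _ => hc γ, Finset.sum_comm]
          rw [Finset.sum_congr rfl fun β _ => Finset.sum_comm, Finset.sum_comm]
          rw [Finset.sum_congr rfl fun β _ => Finset.sum_comm, Finset.sum_comm]
  have hc0 : c 0 = A.card := by
    simp only [c, add_zero]
    congr 2
    exact Finset.filter_true_of_mem fun _ h => h
  have hcγ (γ : ℝ) (hγ : γ ∈ Γ) : c γ * ψ γ ≤ A.card * (ψ γ + η * |ψ γ|) := by
    have h1 : c γ ≤ A.card := by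
      simp only [c]
      exact_mod_cast Finset.card_filter_le _ _
    have h2 : (1 - η) * A.card ≤ c γ := by
      have h : (2 * A.card : ℝ) ≤ c γ + (boxSums Γ (N + 1)).card := by
        have := card_filter_add_mem_ge (N := N) hγ
        simp only [c]
        exact_mod_cast this
      nlinarith
    have h3 : (c γ - A.card) * ψ γ ≤ η * A.card * |ψ γ| := by
      refine (le_abs_self _).trans ?_
      rw [abs_mul]
      refine mul_le_mul_of_nonneg_right ?_ (abs_nonneg _)
      rw [abs_le]
      constructor <;> nlinarith
    nlinarith
  have hfin := (hpos A).trans (hle.trans (add_le_add_right (Finset.sum_le_sum hcγ) _))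
  rw [hc0, ← Finset.mul_sum, ← mul_add, Finset.sum_add_distrib, ← Finset.mul_sum] at hfin
  have := (mul_nonneg_iff_of_pos_left hA0).1 hfin
  change 0 ≤ ψ 0 + (∑ γ ∈ Γ, ψ γ + η * T) at this
  linarith

end LittlewoodPi

namespace LittlewoodPi

open MeasureTheory Set Filter Topology

theorem antitoneOn_one_div_log : AntitoneOn (fun t : ℝ => 1 / Real.log t) (Ici 2) := by
  intro a ha b hb hab
  have ha' : (2 : ℝ) ≤ a := ha
  exact one_div_le_one_div_of_le (Real.log_pos (by linarith))
    (Real.log_le_log (by linarith) hab)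

theorem intervalIntegrable_one_div_log {a b : ℝ} (ha : 2 ≤ a) (hb : 2 ≤ b) :
    IntervalIntegrable (fun t : ℝ => 1 / Real.log t) volume a b :=
  (antitoneOn_one_div_log.mono fun _ hx => le_trans (le_min ha hb) hx.1).intervalIntegrable

theorem Li_eq_add_floor {t : ℝ} (ht : 2 ≤ t) :
    Li t = (∫ u in (2 : ℝ)..⌊t⌋₊, 1 / Real.log u) + ∫ u in (⌊t⌋₊ : ℝ)..t, 1 / Real.log u := by
  have h2 : (2 : ℝ) ≤ ⌊t⌋₊ := by exact_mod_cast Nat.le_floor (by exact_mod_cast ht)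
  exact (intervalIntegral.integral_add_adjacent_intervals
    (intervalIntegrable_one_div_log le_rfl h2) (intervalIntegrable_one_div_log h2 ht)).symm

theorem Li_le_sum {t : ℝ} (ht : 2 ≤ t) :
    Li t ≤ ∑ k ∈ Finset.Icc 2 ⌊t⌋₊, 1 / Real.log k := by
  have h2 : 2 ≤ ⌊t⌋₊ := Nat.le_floor (by exact_mod_cast ht)
  have h2' : (2 : ℝ) ≤ ⌊t⌋₊ := by exact_mod_cast h2
  have hft : (⌊t⌋₊ : ℝ) ≤ t := Nat.floor_le (by linarith)
  rw [Li_eq_add_floor ht, ← Finset.Ico_add_one_right_eq_Icc, Finset.sum_Ico_succ_top h2]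
  refine add_le_add ?_ ?_
  · have := AntitoneOn.integral_le_sum_Ico (f := fun u : ℝ => 1 / Real.log u) h2
      (antitoneOn_one_div_log.mono fun x hx => by
        have := hx.1; simp only [Nat.cast_ofNat] at this; exact this)
    simpa using this
  · have hle : ∫ u in (⌊t⌋₊ : ℝ)..t, 1 / Real.log u ≤
        ∫ u in (⌊t⌋₊ : ℝ)..t, 1 / Real.log ⌊t⌋₊ :=
      intervalIntegral.integral_mono_on hft (intervalIntegrable_one_div_log h2' ht) (by simp)
        fun u hu => antitoneOn_one_div_log h2' (h2'.trans hu.1) hu.1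
    rw [intervalIntegral.integral_const, smul_eq_mul] at hle
    refine hle.trans (mul_le_of_le_one_left ?_ ?_)
    · exact one_div_nonneg.2 (Real.log_nonneg (by linarith))
    · linarith [Nat.lt_floor_add_one t]

theorem sum_le_Li {t : ℝ} (ht : 2 ≤ t) :
    ∑ k ∈ Finset.Icc 2 ⌊t⌋₊, 1 / Real.log k ≤ 2 + Li t := by
  have h2 : 2 ≤ ⌊t⌋₊ := Nat.le_floor (by exact_mod_cast ht)
  have h2' : (2 : ℝ) ≤ ⌊t⌋₊ := by exact_mod_cast h2
  have hft : (⌊t⌋₊ : ℝ) ≤ t := Nat.floor_le (by linarith)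
  rw [Li_eq_add_floor ht, ← Finset.add_sum_Ioc_eq_sum_Icc h2]
  have h1 := AntitoneOn.sum_le_integral_Ico (f := fun u : ℝ => 1 / Real.log u) h2
      (antitoneOn_one_div_log.mono fun x hx => by
        have := hx.1; simp only [Nat.cast_ofNat] at this; exact this)
  have h3 : ∑ k ∈ Finset.Ioc 2 ⌊t⌋₊, 1 / Real.log k =
      ∑ i ∈ Finset.Ico 2 ⌊t⌋₊, 1 / Real.log ((i + 1 : ℕ) : ℝ) := by
    rw [Finset.sum_Ico_add' (fun k : ℕ => 1 / Real.log (k : ℝ)) 2 ⌊t⌋₊ 1]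
    rfl
  have h4 : 0 ≤ ∫ u in (⌊t⌋₊ : ℝ)..t, 1 / Real.log u :=
    intervalIntegral.integral_nonneg hft fun u hu =>
      one_div_nonneg.2 (Real.log_nonneg (by linarith [hu.1]))
  have h5 : 1 / Real.log (2 : ℕ) ≤ 2 := by
    rw [div_le_iff₀ (Real.log_pos (by norm_num))]
    have := Real.log_two_gt_d9
    push_cast
    linarith
  rw [h3]
  push_cast at h1 h5 ⊢
  linarith

/-- `1 / log n` minus the indicator of the primes, with value `0` at `0` and `1`. -/
noncomputable def primeDefect (n : ℕ) : ℝ :=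
  if n < 2 then 0 else 1 / Real.log n - if n.Prime then 1 else 0

theorem abs_primeDefect_le (n : ℕ) : |primeDefect n| ≤ 2 := by
  unfold primeDefect
  split_ifs with h1 h2
  · norm_num
  all_goals
    have h : 1 / Real.log n ≤ 1 / Real.log 2 :=
      antitoneOn_one_div_log (mem_Ici.2 le_rfl)
        (mem_Ici.2 (by exact_mod_cast not_lt.1 h1)) (by exact_mod_cast not_lt.1 h1)
    have h5 : 1 / Real.log 2 ≤ 2 := by
      rw [div_le_iff₀ (Real.log_pos (by norm_num))]
      linarith [Real.log_two_gt_d9]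
    have h6 : 0 ≤ 1 / Real.log n := one_div_nonneg.2 (Real.log_natCast_nonneg n)
    rw [abs_le]
    constructor <;> linarith

theorem sum_primeDefect (t : ℝ) :
    ∑ k ∈ Finset.Icc 1 ⌊t⌋₊, primeDefect k =
      ∑ k ∈ Finset.Icc 2 ⌊t⌋₊, 1 / Real.log k - primePi t := by
  have h1 : ∑ k ∈ Finset.Icc 1 ⌊t⌋₊, primeDefect k =
      ∑ k ∈ Finset.Icc 2 ⌊t⌋₊, primeDefect k := by
    refine (Finset.sum_subset (Finset.Icc_subset_Icc_left one_le_two) fun k hk hk' => ?_).symm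
    rw [Finset.mem_Icc] at hk hk'
    rw [primeDefect, if_pos (by omega)]
  have h2 : ∑ k ∈ Finset.Icc 2 ⌊t⌋₊, primeDefect k =
      ∑ k ∈ Finset.Icc 2 ⌊t⌋₊, (1 / Real.log k - if k.Prime then (1 : ℝ) else 0) :=
    Finset.sum_congr rfl fun k hk => by
      rw [primeDefect, if_neg (by have := (Finset.mem_Icc.1 hk).1; omega)]
  rw [h1, h2, Finset.sum_sub_distrib, Finset.sum_boole, primePi, Nat.primeCounting,
    Nat.primeCounting', Nat.count_eq_card_filter_range]
  congr 3
  ext k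
  simp only [Finset.mem_filter, Finset.mem_Icc, Finset.mem_range]
  constructor
  · rintro ⟨⟨_, h⟩, hp⟩
    exact ⟨by omega, hp⟩
  · rintro ⟨h, hp⟩
    exact ⟨⟨hp.two_le, by omega⟩, hp⟩

/-- The Dirichlet coefficients `ε (1 / log n - 1_{n prime})`, with the value at `1` set to `C`. -/
noncomputable def defectCoeff (ε C : ℝ) (n : ℕ) : ℝ := (if n = 1 then C else 0) + ε * primeDefect n

/-- The summatory function of `defectCoeff`. -/
noncomputable def defectSum (ε C t : ℝ) : ℝ := ∑ k ∈ Finset.Icc 1 ⌊t⌋₊, defectCoeff ε C k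

theorem defectSum_eq (ε C : ℝ) {t : ℝ} (ht : 1 ≤ t) :
    defectSum ε C t = C + ε * ∑ k ∈ Finset.Icc 1 ⌊t⌋₊, primeDefect k := by
  have : 1 ≤ ⌊t⌋₊ := Nat.le_floor (by exact_mod_cast ht)
  simp only [defectSum, defectCoeff, Finset.sum_add_distrib, ← Finset.mul_sum]
  rw [Finset.sum_ite_eq', if_pos (by simp [this])]

theorem abs_sum_primeDefect_le {t : ℝ} (ht : 1 ≤ t) :
    |∑ k ∈ Finset.Icc 1 ⌊t⌋₊, primeDefect k| ≤ 2 * t := by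
  refine (Finset.abs_sum_le_sum_abs _ _).trans
    ((Finset.sum_le_sum fun k _ => abs_primeDefect_le k).trans ?_)
  simp only [Finset.sum_const, Nat.card_Icc, Nat.add_sub_cancel, nsmul_eq_mul]
  linarith [Nat.floor_le (show 0 ≤ t by linarith)]

theorem exists_defectSum_nonneg_of_le {X : ℝ} (h : ∀ x, X < x → (primePi x : ℝ) ≤ Li x) :
    ∃ C, ∀ t, 1 ≤ t → 0 ≤ defectSum 1 C t := by
  refine ⟨2 * max X 2, fun t ht => ?_⟩
  rw [defectSum_eq _ _ ht, one_mul]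
  rcases le_or_gt t (max X 2) with h1 | h1
  · linarith [(abs_le.1 (abs_sum_primeDefect_le ht)).1]
  · obtain ⟨h2, h3⟩ := max_lt_iff.1 h1
    rw [sum_primeDefect]
    linarith [Li_le_sum h3.le, h t h2, le_max_right X 2]

theorem exists_defectSum_nonneg_of_ge {X : ℝ} (h : ∀ x, X < x → Li x ≤ (primePi x : ℝ)) :
    ∃ C, ∀ t, 1 ≤ t → 0 ≤ defectSum (-1) C t := by
  refine ⟨2 * max X 2, fun t ht => ?_⟩
  rw [defectSum_eq _ _ ht]
  rcases le_or_gt t (max X 2) with h1 | h1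
  · linarith [(abs_le.1 (abs_sum_primeDefect_le ht)).2]
  · obtain ⟨h2, h3⟩ := max_lt_iff.1 h1
    rw [sum_primeDefect]
    linarith [sum_le_Li h3.le, h t h2, le_max_right X 2]

theorem measurable_defectSum (ε C : ℝ) : Measurable (defectSum ε C) :=
  (measurable_from_nat (f := fun n => ∑ k ∈ Finset.Icc 1 n, defectCoeff ε C k)).comp
    Nat.measurable_floor

theorem defectSum_le {ε C : ℝ} (hε : |ε| ≤ 1) {t : ℝ} (ht : 1 ≤ t) :
    defectSum ε C t ≤ (|C| + 2) * t := by
  rw [defectSum_eq _ _ ht]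
  have h1 : ε * ∑ k ∈ Finset.Icc 1 ⌊t⌋₊, primeDefect k ≤ 2 * t := by
    refine (le_abs_self _).trans ?_
    rw [abs_mul]
    exact (mul_le_of_le_one_left (abs_nonneg _) hε).trans (abs_sum_primeDefect_le ht)
  have h2 : C ≤ |C| * t := (le_abs_self C).trans (le_mul_of_one_le_right (abs_nonneg _) ht)
  linarith

theorem abs_defectCoeff_le {ε C : ℝ} (hε : |ε| ≤ 1) (n : ℕ) : |defectCoeff ε C n| ≤ |C| + 2 := by
  unfold defectCoeff
  refine (abs_add_le _ _).trans (add_le_add ?_ ?_)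
  · split_ifs <;> simp
  · rw [abs_mul]
    exact (mul_le_of_le_one_left (abs_nonneg _) hε).trans (abs_primeDefect_le n)

end LittlewoodPi

namespace LittlewoodPi

open MeasureTheory Set Filter Topology Metric

variable {ε C : ℝ}

/-- The regular part of the derivative of the Dirichlet series of `defectCoeff`. -/
noncomputable def regularPart (s : ℂ) : ℂ := dslope zetaMul 1 s - 1 + primePowerSeries s

theorem differentiableOn_regularPart : DifferentiableOn ℂ regularPart {s | 1 / 2 < s.re} :=
  ((differentiable_dslope_zetaMul.differentiableOn).sub_const 1).add
    differentiableOn_primePowerSeries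

theorem isBigO_sum_norm_defectCoeff (hε : |ε| ≤ 1) :
    (fun n : ℕ => ∑ k ∈ Finset.Icc 1 n, ‖(defectCoeff ε C k : ℂ)‖) =O[atTop]
      fun n : ℕ => (n : ℝ) ^ (1 : ℝ) := by
  refine Asymptotics.IsBigO.of_bound (|C| + 2) (Eventually.of_forall fun n => ?_)
  rw [Real.norm_of_nonneg (Finset.sum_nonneg fun _ _ => norm_nonneg _), Real.rpow_one,
    Real.norm_natCast]
  refine (Finset.sum_le_sum fun k _ => ?_).trans_eq (b := ∑ k ∈ Finset.Icc 1 n, (|C| + 2)) ?_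
  · rw [Complex.norm_real]
    exact abs_defectCoeff_le hε k
  · simp
    ring

theorem lSeriesSummable_defectCoeff (hε : |ε| ≤ 1) {s : ℂ} (hs : 1 < s.re) :
    LSeriesSummable (fun n => (defectCoeff ε C n : ℂ)) s :=
  LSeriesSummable_of_sum_norm_bigO (isBigO_sum_norm_defectCoeff hε) zero_le_one hs

theorem lSeries_defectCoeff (hε : |ε| ≤ 1) (hS : ∀ t, 1 ≤ t → 0 ≤ defectSum ε C t) {s : ℂ}
    (hs : 1 < s.re) :
    s * mellinOne (defectSum ε C) s = LSeries (fun n => (defectCoeff ε C n : ℂ)) s := by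
  rw [LSeries_eq_mul_integral' _ zero_le_one hs (isBigO_sum_norm_defectCoeff hε),
    mellinOne_eq (measurable_defectSum ε C) fun t ht => hS t ht.le]
  simp only [defectSum, Complex.ofReal_sum]

theorem Ioi_one_subset_mellinSet (hε : |ε| ≤ 1) (hS : ∀ t, 1 ≤ t → 0 ≤ defectSum ε C t) :
    Ioi 1 ⊆ mellinSet (defectSum ε C) :=
  Ioi_subset_mellinSet_of_le_rpow (measurable_defectSum ε C) (fun t ht => hS t ht.le)
    (C := |C| + 2) fun t ht => by
      rw [Real.rpow_one]
      exact defectSum_le hε ht.le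

theorem lSeriesSummable_delta (s : ℂ) : LSeriesSummable LSeries.delta s := by
  refine summable_of_hasFiniteSupport ((finite_singleton 1).subset fun n hn => ?_)
  by_contra h
  exact hn (by rw [LSeries.term_delta, if_neg (by simpa using h)])

theorem logMul_defectCoeff {n : ℕ} (hn : n ≠ 0) :
    LSeries.logMul (fun n => (defectCoeff ε C n : ℂ)) n =
      ((ε : ℂ) • (((1 : ℕ → ℂ) - LSeries.delta) - fun n => (primeLog n : ℂ))) n := by
  rw [LSeries.logMul, ← Complex.natCast_log]
  simp only [Pi.smul_apply, Pi.sub_apply, Pi.one_apply, smul_eq_mul, LSeries.delta]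
  unfold defectCoeff primeDefect primeLog
  by_cases h1 : n = 1
  · simp [h1, Nat.not_prime_one]
  · have h2 : ¬ n < 2 := by omega
    have h3 : (Real.log n : ℂ) ≠ 0 := by
      exact_mod_cast (Real.log_pos (by exact_mod_cast (by omega : 1 < n))).ne'
    rw [if_neg h1, if_neg h2, if_neg h1]
    split_ifs <;> push_cast at h3 ⊢ <;> field_simp <;> ring

theorem deriv_mul_mellinOne (hε : |ε| ≤ 1) (hS : ∀ t, 1 ≤ t → 0 ≤ defectSum ε C t) {s : ℂ}
    (hs : 1 < s.re) :
    deriv (fun s => s * mellinOne (defectSum ε C) s) s =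
      -(ε * (regularPart s + deriv zetaMul s / zetaMul s)) := by
  have hev : (fun s => s * mellinOne (defectSum ε C) s) =ᶠ[𝓝 s]
      LSeries (fun n => (defectCoeff ε C n : ℂ)) := by
    filter_upwards [(isOpen_re_gt 1).mem_nhds hs] with z hz
    exact lSeries_defectCoeff hε hS hz
  have hab : LSeries.abscissaOfAbsConv (fun n => (defectCoeff ε C n : ℂ)) < s.re := by
    refine lt_of_le_of_lt (LSeries.abscissaOfAbsConv_le_of_forall_lt_LSeriesSummable (x := 1)
      fun y hy => lSeriesSummable_defectCoeff hε (by simpa using hy)) ?_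
    exact_mod_cast hs
  have hs1 : s ≠ 1 := by rintro rfl; simp at hs
  have hζ : riemannZeta s ≠ 0 := riemannZeta_ne_zero_of_one_lt_re hs
  rw [hev.deriv_eq, LSeries_deriv hab, LSeries_congr fun {n} hn => logMul_defectCoeff hn,
    LSeries_smul, LSeries_sub, LSeries_sub, LSeries_one_eq_riemannZeta hs, LSeries_delta,
    lSeries_primeLog hs, regularPart, dslope_zetaMul hs1, deriv_zetaMul_div hs1 hζ,
    ← primePowerSeries]
  · simp only [Pi.one_apply]
    ring
  · exact LSeriesSummable_one_iff.2 hs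
  · exact lSeriesSummable_delta s
  · exact (LSeriesSummable_one_iff.2 hs).sub (lSeriesSummable_delta s)
  · exact lSeriesSummable_primeLog hs

theorem differentiableOn_mul_mellinOne {h : ℝ → ℝ} {c : ℝ} (hc : Ioi c ⊆ mellinSet h) :
    DifferentiableOn ℂ (fun s => s * mellinOne h s) {s | c < s.re} :=
  differentiableOn_id.mul (differentiableOn_mellinOne hc)

theorem zetaMul_identity (hε : |ε| = 1) (hS : ∀ t, 1 ≤ t → 0 ≤ defectSum ε C t) {c : ℝ}
    (hc : 1 / 2 ≤ c) (hI : Ioi c ⊆ mellinSet (defectSum ε C)) {s : ℂ} (hs : c < s.re) :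
    zetaMul s * (ε * deriv (fun s => s * mellinOne (defectSum ε C) s) s + regularPart s)
      + deriv zetaMul s = 0 := by
  refine eqOn_re_gt (c := c) (d := 1) (f := fun s => zetaMul s *
    (ε * deriv (fun s => s * mellinOne (defectSum ε C) s) s + regularPart s) + deriv zetaMul s)
    (g := fun _ => 0) ?_ (differentiableOn_const 0) (fun s hs => ?_) hs
  · refine (differentiable_zetaMul.differentiableOn.mul
      ((((differentiableOn_mul_mellinOne hI).deriv (isOpen_re_gt c)).const_mul _).add
        (differentiableOn_regularPart.mono fun s hs => lt_of_le_of_lt hc hs))).add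
        differentiable_zetaMul.deriv.differentiableOn
  · have hZ : zetaMul s ≠ 0 := zetaMul_ne_zero_of_one_le_re hs.le
    have hε2 : (ε : ℂ) * ε = 1 := by
      have : ε * ε = 1 := by rw [← abs_mul_abs_self, hε, one_mul]
      exact_mod_cast this
    rw [deriv_mul_mellinOne hε.le hS hs]
    field_simp
    linear_combination -(zetaMul s * regularPart s + deriv zetaMul s) * hε2

theorem exists_lt_mem_mellinSet (hε : |ε| = 1) (hS : ∀ t, 1 ≤ t → 0 ≤ defectSum ε C t) {c : ℝ}
    (hc : 1 / 2 < c) (hI : Ioi c ⊆ mellinSet (defectSum ε C)) :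
    ∃ c' < c, c' ∈ mellinSet (defectSum ε C) := by
  set L : ℂ → ℂ := fun s => s * mellinOne (defectSum ε C) s with hL
  have hnhds : {s : ℂ | 1 / 2 < s.re ∧ zetaMul s ≠ 0} ∈ 𝓝 (c : ℂ) := by
    refine inter_mem ((isOpen_re_gt (1 / 2)).mem_nhds (by simpa using hc)) ?_
    exact differentiable_zetaMul.continuous.continuousAt.eventually_ne
      (zetaMul_ofReal_ne_zero (by linarith))
  obtain ⟨δ, hδ, hball⟩ := Metric.mem_nhds_iff.1 hnhds
  have hW : DifferentiableOn ℂ (fun s => regularPart s + deriv zetaMul s / zetaMul s)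
      (ball (c : ℂ) δ) := by
    refine (differentiableOn_regularPart.mono fun s hs => (hball hs).1).add ?_
    exact differentiable_zetaMul.deriv.differentiableOn.div differentiable_zetaMul.differentiableOn
      fun s hs => (hball hs).2
  obtain ⟨P, hP⟩ := hW.isExactOn_ball
  set U : Set ℂ := ball (c : ℂ) δ ∩ {s | c < s.re} with hU
  have hUo : IsOpen U := isOpen_ball.inter (isOpen_re_gt c)
  have hUc : IsPreconnected U :=
    ((convex_ball (c : ℂ) δ).inter (convex_halfSpace_re_gt c)).isPreconnected
  have hLd (z : ℂ) (hz : z ∈ U) : HasDerivAt L (deriv L z) z :=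
    (((differentiableOn_mul_mellinOne hI) z hz.2).differentiableAt
      ((isOpen_re_gt c).mem_nhds hz.2)).hasDerivAt
  have hsum (z : ℂ) (hz : z ∈ U) : HasDerivAt (fun z => ε * L z + P z) 0 z := by
    have h1 := zetaMul_identity hε hS hc.le hI hz.2
    have hZ := (hball hz.1).2
    refine (((hLd z hz).const_mul (ε : ℂ)).add (hP z hz.1)).congr_deriv ?_
    field_simp
    linear_combination h1
  obtain ⟨k, hk⟩ : ∃ k, ∀ z ∈ U, ε * L z + P z = k := by
    rcases U.eq_empty_or_nonempty with h0 | ⟨x, hx⟩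
    · exact ⟨0, fun z hz => by simp [h0] at hz⟩
    · exact ⟨_, fun z hz => hUo.is_const_of_deriv_eq_zero hUc
        (fun z hz => (hsum z hz).differentiableAt.differentiableWithinAt)
        (fun z hz => (hsum z hz).deriv) hz hx⟩
  have hε2 : (ε : ℂ) * ε = 1 := by
    have : ε * ε = 1 := by rw [← abs_mul_abs_self, hε, one_mul]
    exact_mod_cast this
  have hne (z : ℂ) (hz : z ∈ ball (c : ℂ) δ) : z ≠ 0 := by
    rintro rfl
    have := (hball hz).1
    norm_num at this
  refine exists_lt_mem_integrableExpSet (Real.measurable_log.neg) mellinMeasure_ae_nonpos hδ hI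
    (Φ := fun z => ε * (k - P z) / z) ?_ fun z hz hz' => ?_
  · refine DifferentiableOn.div ?_ differentiableOn_id hne
    exact ((differentiableOn_const k).sub fun z hz =>
      (hP z hz).differentiableAt.differentiableWithinAt).const_mul _
  · have h1 := hk z ⟨hz, hz'⟩
    have h2 := hne z hz
    change mellinOne (defectSum ε C) z = _
    rw [eq_div_iff h2, ← h1]
    simp only [hL]
    linear_combination (-(z * mellinOne (defectSum ε C) z)) * hε2

theorem Ioi_half_subset_mellinSet (hε : |ε| = 1) (hS : ∀ t, 1 ≤ t → 0 ≤ defectSum ε C t) :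
    Ioi (1 / 2) ⊆ mellinSet (defectSum ε C) := by
  intro σ₀ hσ₀
  have hσ₀' : (1 / 2 : ℝ) < σ₀ := hσ₀
  have hm := measurable_defectSum ε C
  have hS' : ∀ t, 1 < t → 0 ≤ defectSum ε C t := fun t ht => hS t ht.le
  by_contra hcon
  have hbd : σ₀ ∈ lowerBounds (mellinSet (defectSum ε C)) := fun τ hτ => by
    by_contra! hlt
    exact hcon (mellinSet_upward hm hS' hlt.le hτ)
  have hne : (mellinSet (defectSum ε C)).Nonempty :=
    ⟨2, Ioi_one_subset_mellinSet hε.le hS (by norm_num : (1 : ℝ) < 2)⟩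
  have hle : σ₀ ≤ sInf (mellinSet (defectSum ε C)) := le_csInf hne hbd
  obtain ⟨c', hc', hmem⟩ := exists_lt_mem_mellinSet hε hS (hσ₀'.trans_le hle) fun σ hσ => by
    obtain ⟨τ, hτ, hlt⟩ := exists_lt_of_csInf_lt hne (mem_Ioi.1 hσ)
    exact mellinSet_upward hm hS' hlt.le hτ
  exact absurd (csInf_le ⟨σ₀, hbd⟩ hmem) (not_le.2 hc')

theorem eq_zero_of_deriv_add_mul_eq_zero {f G : ℂ → ℂ} {w : ℂ} {r : ℝ} (hr : 0 < r)
    (hf : Differentiable ℂ f) (hG : DifferentiableOn ℂ G (ball w r))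
    (h : ∀ z ∈ ball w r, f z * G z + deriv f z = 0) (hw : f w = 0) : f = 0 := by
  obtain ⟨Q, hQ⟩ := hG.isExactOn_ball
  have hd (z : ℂ) (hz : z ∈ ball w r) : HasDerivAt (fun z => f z * Complex.exp (Q z)) 0 z := by
    refine ((hf z).hasDerivAt.mul (hQ z hz).cexp).congr_deriv ?_
    linear_combination Complex.exp (Q z) * h z hz
  have hz (z : ℂ) (hz : z ∈ ball w r) : f z = 0 := by
    have := isOpen_ball.is_const_of_deriv_eq_zero (convex_ball w r).isPreconnected
      (fun z hz => (hd z hz).differentiableAt.differentiableWithinAt)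
      (fun z hz => (hd z hz).deriv) hz (mem_ball_self hr)
    simpa [hw, Complex.exp_ne_zero] using this
  refine AnalyticOnNhd.eq_of_eventuallyEq (z₀ := w)
    (fun z _ => hf.analyticAt z) (fun z _ => analyticAt_const) ?_
  filter_upwards [ball_mem_nhds w hr] with z hz' using hz z hz'

theorem zetaMul_ne_zero_of_half_lt (hε : |ε| = 1) (hS : ∀ t, 1 ≤ t → 0 ≤ defectSum ε C t) {s : ℂ}
    (hs : 1 / 2 < s.re) : zetaMul s ≠ 0 := by
  intro h0
  have hI := Ioi_half_subset_mellinSet hε hS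
  obtain ⟨r, hr, hball⟩ := Metric.mem_nhds_iff.1 ((isOpen_re_gt (1 / 2)).mem_nhds hs)
  have := eq_zero_of_deriv_add_mul_eq_zero hr differentiable_zetaMul
    (G := fun s => ε * deriv (fun s => s * mellinOne (defectSum ε C) s) s + regularPart s)
    (((((differentiableOn_mul_mellinOne hI).deriv (isOpen_re_gt _)).const_mul _).add
        differentiableOn_regularPart).mono hball)
    (fun z hz => zetaMul_identity hε hS le_rfl hI (hball hz)) h0
  have h1 := zetaMul_one
  rw [this] at h1
  simp at h1

theorem re_eq_zero_of_xi_half_add_eq_zero (hε : |ε| = 1)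
    (hS : ∀ t, 1 ≤ t → 0 ≤ defectSum ε C t) {z : ℂ} (hz : xi (1 / 2 + z) = 0) : z.re = 0 := by
  have key (w : ℂ) (hw : 0 < w.re) : xi (1 / 2 + w) ≠ 0 := by
    have h1 : (1 / 2 + w).re = 1 / 2 + w.re := by simp
    rw [Ne, xi_eq_zero_iff (by rw [h1]; linarith)]
    exact zetaMul_ne_zero_of_half_lt hε hS (by rw [h1]; linarith)
  rcases lt_trichotomy z.re 0 with h | h | h
  · have := key (-z) (by simpa using h)
    rw [← xi_one_sub] at this
    exact absurd hz (by convert this using 3; ring)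
  · exact h
  · exact absurd hz (key z h)

end LittlewoodPi

namespace LittlewoodPi

open MeasureTheory Set Filter Topology Metric ProbabilityTheory

variable {ε C : ℝ}

/-- The multiplicity of `1/2 + il` as a zero of `xi`. -/
noncomputable def zeroOrder (l : ℝ) : ℕ :=
  analyticOrderNatAt (fun z => xi (1 / 2 + z)) (l * Complex.I)

theorem analyticOrderNatAt_zetaMul_half_add (l : ℝ) :
    analyticOrderNatAt (fun z => zetaMul (1 / 2 + z)) (l * Complex.I) = zeroOrder l := by
  set w : ℂ := l * Complex.I
  have hre : (1 / 2 + w).re = 1 / 2 := by simp [w]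
  have hd : Differentiable ℂ fun z : ℂ => 1 / 2 + z := by fun_prop
  have hX : AnalyticAt ℂ (fun z => xi (1 / 2 + z)) w := (differentiable_xi.comp hd).analyticAt w
  have hZ : AnalyticAt ℂ (fun z => zetaMul (1 / 2 + z)) w :=
    (differentiable_zetaMul.comp hd).analyticAt w
  have hG : AnalyticAt ℂ (fun z => (Complex.Gammaℝ (1 / 2 + z))⁻¹) w :=
    (Complex.differentiable_Gammaℝ_inv.comp hd).analyticAt w
  have hI : AnalyticAt ℂ (fun z : ℂ => 1 / 2 + z) w := hd.analyticAt w
  have hev : ∀ᶠ z in 𝓝 w, 0 < (1 / 2 + z).re :=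
    (Complex.continuous_re.comp hd.continuous).continuousAt.eventually
      (lt_mem_nhds (by simp only [Function.comp]; rw [hre]; norm_num))
  have heq : (fun z => (1 / 2 + z)) * (fun z => zetaMul (1 / 2 + z)) =ᶠ[𝓝 w]
      (fun z => xi (1 / 2 + z)) * fun z => (Complex.Gammaℝ (1 / 2 + z))⁻¹ := by
    filter_upwards [hev] with z hz
    have := Complex.Gammaℝ_ne_zero_of_re_pos hz
    simp only [Pi.mul_apply]
    rw [xi_eq_mul_zetaMul hz]
    generalize (1 / 2 + z) = u at *
    field_simp
  have hord := analyticOrderAt_congr heq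
  have hre0 : 0 < (1 / 2 + w).re := by rw [hre]; norm_num
  rw [analyticOrderAt_mul hI hZ, analyticOrderAt_mul hX hG,
    hI.analyticOrderAt_eq_zero.2 (by intro h; rw [h] at hre0; simp at hre0),
    hG.analyticOrderAt_eq_zero.2 (inv_ne_zero (Complex.Gammaℝ_ne_zero_of_re_pos hre0)),
    zero_add, add_zero] at hord
  rw [zeroOrder, analyticOrderNatAt, analyticOrderNatAt, hord]

theorem zeroOrder_zero : zeroOrder 0 = 0 := by
  have hd : Differentiable ℂ fun z : ℂ => zetaMul (1 / 2 + z) :=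
    differentiable_zetaMul.comp (by fun_prop)
  rw [← analyticOrderNatAt_zetaMul_half_add, analyticOrderNatAt,
    (hd.analyticAt _).analyticOrderAt_eq_zero.2 ?_, ENat.toNat_zero]
  have := zetaMul_ofReal_ne_zero (σ := 1 / 2) (by norm_num)
  simpa using this

theorem tendsto_ofReal_nhdsGT_zero :
    Tendsto (fun σ : ℝ => (σ : ℂ)) (𝓝[>] 0) (𝓝 0) := by
  have : Tendsto (fun σ : ℝ => (σ : ℂ)) (𝓝 0) (𝓝 ((0 : ℝ) : ℂ)) :=
    Complex.continuous_ofReal.continuousAt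
  rw [Complex.ofReal_zero] at this
  exact this.mono_left nhdsWithin_le_nhds

theorem tendsto_mul_logDeriv_zetaMul (l : ℝ) :
    Tendsto (fun σ : ℝ => (σ : ℂ) * (deriv zetaMul (1 / 2 + σ + l * Complex.I) /
      zetaMul (1 / 2 + σ + l * Complex.I))) (𝓝[>] 0) (𝓝 (zeroOrder l)) := by
  set w : ℂ := l * Complex.I with hw
  have hd : Differentiable ℂ fun z : ℂ => zetaMul (1 / 2 + z) :=
    differentiable_zetaMul.comp (by fun_prop)
  obtain ⟨g, hg, hgw, hfac⟩ := exists_eq_sub_pow_mul hd (w₀ := 1 / 2)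
    (by norm_num [zetaMul_one]) w
  rw [analyticOrderNatAt_zetaMul_half_add] at hfac
  set m := zeroOrder l
  have hσw : Tendsto (fun σ : ℝ => (σ : ℂ) + w) (𝓝[>] 0) (𝓝 w) := by
    simpa using tendsto_ofReal_nhdsGT_zero.add_const w
  have hlim : Tendsto (fun σ : ℝ => (m : ℂ) + σ * (deriv g (σ + w) / g (σ + w))) (𝓝[>] 0)
      (𝓝 (m + 0 * (deriv g w / g w))) :=
    tendsto_const_nhds.add (tendsto_ofReal_nhdsGT_zero.mul
      (((hg.deriv.continuous.tendsto w).comp hσw).div ((hg.continuous.tendsto w).comp hσw) hgw))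
  rw [zero_mul, add_zero] at hlim
  refine hlim.congr' ?_
  filter_upwards [self_mem_nhdsWithin,
    hσw.eventually (hg.continuous.continuousAt.eventually_ne hgw)] with σ hσ hgσ
  have hσ0 : (σ : ℂ) ≠ 0 := by exact_mod_cast (ne_of_gt hσ)
  have h1 : HasDerivAt (fun z => zetaMul (1 / 2 + z)) (deriv zetaMul (1 / 2 + (σ + w))) (σ + w) :=
    (differentiable_zetaMul _).hasDerivAt.comp_const_add (1 / 2) (σ + w)
  have h2 : HasDerivAt (fun z => (z - w) ^ m * g z)
      (m * (σ + w - w) ^ (m - 1) * 1 * g (σ + w) + (σ + w - w) ^ m * deriv g (σ + w)) (σ + w) :=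
    (((hasDerivAt_id (σ + w : ℂ)).sub_const w).pow m).mul (hg _).hasDerivAt
  rw [show (fun z => zetaMul (1 / 2 + z)) = fun z => (z - w) ^ m * g z from funext hfac] at h1
  have h3 := h1.unique h2
  rw [show (1 / 2 + σ + w : ℂ) = 1 / 2 + (σ + w) by ring, h3, hfac, add_sub_cancel_right]
  rcases Nat.eq_zero_or_pos m with hm | hm
  · simp [hm]
  · have : (σ : ℂ) ^ m = σ ^ (m - 1) * σ := by rw [← pow_succ]; congr 1; omega
    rw [this]
    field_simp

/-- `ε` times the residue at `1/2 + il` of the derivative of the Dirichlet series of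
`defectCoeff`, up to sign. -/
noncomputable def residueAt (l : ℝ) : ℝ := zeroOrder l + if l = 0 then 1 / 2 else 0

theorem tendsto_mul_deriv (hε : |ε| = 1) (hS : ∀ t, 1 ≤ t → 0 ≤ defectSum ε C t) (l : ℝ) :
    Tendsto (fun σ : ℝ => (σ : ℂ) * deriv (fun s => s * mellinOne (defectSum ε C) s)
      (1 / 2 + σ + l * Complex.I)) (𝓝[>] 0) (𝓝 (-(ε * residueAt l))) := by
  have hσs : Tendsto (fun σ : ℝ => (1 / 2 + (σ : ℂ) + l * Complex.I)) (𝓝[>] 0)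
      (𝓝 (1 / 2 + 0 + l * Complex.I)) :=
    (tendsto_ofReal_nhdsGT_zero.const_add _).add_const _
  have h1 := tendsto_ofReal_nhdsGT_zero.mul
    (((differentiable_dslope_zetaMul.continuous.tendsto _).comp hσs).sub_const 1)
  rw [zero_mul] at h1
  have h2 := ((h1.add (tendsto_mul_primePowerSeries l)).add
    (tendsto_mul_logDeriv_zetaMul l)).const_mul (-(ε : ℂ))
  have h3 : (-(ε : ℂ)) * (0 + (if l = 0 then 1 / 2 else 0) + (zeroOrder l : ℂ)) =
      -(ε * residueAt l) := by
    rw [residueAt]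
    split_ifs <;> push_cast <;> ring
  rw [h3] at h2
  refine h2.congr' ?_
  have hε2 : (ε : ℂ) * ε = 1 := by
    have : ε * ε = 1 := by rw [← abs_mul_abs_self, hε, one_mul]
    exact_mod_cast this
  filter_upwards [self_mem_nhdsWithin] with σ hσ
  have hσ' : (0 : ℝ) < σ := hσ
  have hs : 1 / 2 < (1 / 2 + (σ : ℂ) + l * Complex.I).re := by simp [hσ']
  have hI := Ioi_half_subset_mellinSet hε hS
  have hZ := zetaMul_ne_zero_of_half_lt hε hS hs
  have hid := zetaMul_identity hε hS le_rfl hI hs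
  rw [regularPart] at hid
  simp only [Function.comp]
  generalize (1 / 2 + (σ : ℂ) + l * Complex.I) = s at *
  field_simp
  linear_combination (-(ε * σ : ℂ)) * hid + (σ * zetaMul s *
    deriv (fun s => s * mellinOne (defectSum ε C) s) s) * hε2

end LittlewoodPi

namespace LittlewoodPi

open MeasureTheory Set Filter Topology Metric ProbabilityTheory ComplexConjugate

section general
variable {Ω : Type*} {mΩ : MeasurableSpace Ω} {X : Ω → ℝ} {μ : Measure Ω}

theorem mgf_le_add_integral (hX : ∀ᵐ ω ∂μ, X ω ≤ 0) {s τ K : ℝ} (hs : 0 < s) (hτ : 0 < τ)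
    (hsI : s ∈ interior (integrableExpSet X μ)) (hτI : τ ∈ integrableExpSet X μ) (hK : 0 < K) :
    mgf X μ s ≤ Real.exp (τ * K) * mgf X μ τ - (∫ ω, X ω * Real.exp (s * X ω) ∂μ) / K := by
  have h1 : Integrable (fun ω => Real.exp (s * X ω)) μ :=
    show s ∈ integrableExpSet X μ from interior_subset hsI
  have h2 : Integrable (fun ω => X ω * Real.exp (s * X ω)) μ := by
    simpa using integrable_pow_mul_exp_of_mem_interior_integrableExpSet hsI 1
  have h3 : Integrable (fun ω => Real.exp (τ * X ω)) μ := hτI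
  rw [mgf, mgf, ← integral_const_mul, ← integral_div,
    ← integral_sub (h3.const_mul _) (h2.div_const _)]
  refine integral_mono_ae h1 ((h3.const_mul _).sub (h2.div_const _)) ?_
  filter_upwards [hX] with ω hω
  rw [← Real.exp_add, mul_div_right_comm]
  have he := Real.exp_pos (s * X ω)
  rcases le_or_gt (-K) (X ω) with h | h
  · have h4 : Real.exp (s * X ω) ≤ 1 := Real.exp_le_one_iff.2 (by nlinarith)
    have h5 : 1 ≤ Real.exp (τ * K + τ * X ω) := Real.one_le_exp (by nlinarith)
    have h6 : X ω / K * Real.exp (s * X ω) ≤ 0 :=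
      mul_nonpos_of_nonpos_of_nonneg (div_nonpos_of_nonpos_of_nonneg hω hK.le) he.le
    linarith
  · have h5 : 0 ≤ Real.exp (τ * K + τ * X ω) := (Real.exp_pos _).le
    have h6 : X ω / K ≤ -1 := by
      rw [div_le_iff₀ hK]
      linarith
    nlinarith

/-- Positive-definiteness of the Fourier transform of a one-sided exponential. -/
theorem re_sum_mul_conj_kernel_nonneg {a : ℝ} (ha : 0 < a) (A : Finset ℝ) (c : ℝ → ℂ) :
    0 ≤ (∑ α ∈ A, ∑ β ∈ A, (a / (a + (α - β : ℝ) * Complex.I) : ℂ) * (c α * conj (c β))).re := by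
  have hre (α β : ℝ) : (-(a + (α - β : ℝ) * Complex.I) : ℂ).re < 0 := by simpa using ha
  have h_int (α β : ℝ) : IntegrableOn (fun v : ℝ => (a * (c α * conj (c β))) *
      Complex.exp (-(a + (α - β : ℝ) * Complex.I) * v)) (Ioi 0) :=
    (integrableOn_exp_mul_complex_Ioi (hre α β) 0).const_mul _
  have hterm (α β : ℝ) : (a / (a + (α - β : ℝ) * Complex.I) : ℂ) * (c α * conj (c β)) =
      ∫ v in Ioi (0 : ℝ), (a * (c α * conj (c β))) *
        Complex.exp (-(a + (α - β : ℝ) * Complex.I) * v) := by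
    rw [integral_const_mul, integral_exp_mul_complex_Ioi (hre α β) 0]
    have : (a + (α - β : ℝ) * Complex.I : ℂ) ≠ 0 := fun h => by
      have := hre α β
      rw [h] at this
      simp at this
    simp only [Complex.ofReal_zero, mul_zero, Complex.exp_zero]
    generalize (a + (α - β : ℝ) * Complex.I : ℂ) = d at *
    field_simp
  simp only [hterm]
  simp only [← integral_finsetSum A fun β _ => h_int _ β]
  rw [← integral_finsetSum A fun α _ => integrable_finsetSum A fun β _ => h_int α β]
  rw [← RCLike.re_to_complex]
  rw [← integral_re (integrable_finsetSum A fun α _ => integrable_finsetSum A fun β _ => h_int α β)]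
  refine integral_nonneg fun v => ?_
  have hsq : ∑ α ∈ A, ∑ β ∈ A, (a * (c α * conj (c β))) *
      Complex.exp (-(a + (α - β : ℝ) * Complex.I) * v) =
      ((a * Real.exp (-(a * v)) *
        Complex.normSq (∑ α ∈ A, c α * Complex.exp (-(α * v * Complex.I))) : ℝ) : ℂ) := by
    push_cast
    rw [← Complex.mul_conj, map_sum, Finset.sum_mul_sum, Finset.mul_sum]
    refine Finset.sum_congr rfl fun α _ => ?_
    rw [Finset.mul_sum]
    refine Finset.sum_congr rfl fun β _ => ?_
    rw [map_mul, ← Complex.exp_conj]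
    have : Complex.exp (-(a + (α - β) * Complex.I) * v) = Complex.exp (-(a * v)) *
        (Complex.exp (-(α * v * Complex.I)) * Complex.exp (conj (-(β * v * Complex.I) : ℂ))) := by
      rw [← Complex.exp_add, ← Complex.exp_add]
      congr 1
      simp only [map_neg, map_mul, Complex.conj_I, Complex.conj_ofReal]
      ring
    rw [this]
    ring
  simp only [hsq, RCLike.re_to_complex, Complex.ofReal_re, Pi.zero_apply]
  have := Complex.normSq_nonneg (∑ α ∈ A, c α * Complex.exp (-(α * v * Complex.I)))
  positivity

theorem re_sum_mul_neg_deriv_complexMGF_nonneg (hX : ∀ᵐ ω ∂μ, X ω ≤ 0) {s : ℝ}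
    (hs : s ∈ interior (integrableExpSet X μ)) {a : ℝ} (ha : 0 < a) (A : Finset ℝ) :
    0 ≤ (∑ α ∈ A, ∑ β ∈ A, (a / (a + (α - β : ℝ) * Complex.I) : ℂ) *
      -deriv (complexMGF X μ) (s + (α - β : ℝ) * Complex.I)).re := by
  have hre (l : ℝ) : (s + l * Complex.I : ℂ).re ∈ interior (integrableExpSet X μ) := by
    simpa using hs
  have h_int (α β : ℝ) : Integrable (fun ω => (a / (a + (α - β : ℝ) * Complex.I) : ℂ) *
      -(X ω * Complex.exp ((s + (α - β : ℝ) * Complex.I) * X ω))) μ := by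
    refine Integrable.const_mul (Integrable.neg ?_) _
    simpa using integrable_pow_mul_cexp_of_re_mem_interior_integrableExpSet (hre (α - β)) 1
  have hterm (α β : ℝ) : (a / (a + (α - β : ℝ) * Complex.I) : ℂ) *
      -deriv (complexMGF X μ) (s + (α - β : ℝ) * Complex.I) =
      ∫ ω, (a / (a + (α - β : ℝ) * Complex.I) : ℂ) *
        -(X ω * Complex.exp ((s + (α - β : ℝ) * Complex.I) * X ω)) ∂μ := by
    rw [(hasDerivAt_complexMGF (hre (α - β))).deriv, integral_const_mul, integral_neg]
  simp only [hterm]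
  simp only [← integral_finsetSum A fun β _ => h_int _ β]
  rw [← integral_finsetSum A fun α _ => integrable_finsetSum A fun β _ => h_int α β]
  rw [← RCLike.re_to_complex]
  rw [← integral_re (integrable_finsetSum A fun α _ => integrable_finsetSum A fun β _ => h_int α β)]
  refine integral_nonneg_of_ae ?_
  filter_upwards [hX] with ω hω
  have hsq : ∑ α ∈ A, ∑ β ∈ A, (a / (a + (α - β : ℝ) * Complex.I) : ℂ) *
        -(X ω * Complex.exp ((s + (α - β : ℝ) * Complex.I) * X ω)) =
      ((-X ω * Real.exp (s * X ω) : ℝ) : ℂ) * ∑ α ∈ A, ∑ β ∈ A,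
        (a / (a + (α - β : ℝ) * Complex.I) : ℂ) *
        (Complex.exp (α * X ω * Complex.I) * conj (Complex.exp (β * X ω * Complex.I))) := by
    rw [Finset.mul_sum]
    refine Finset.sum_congr rfl fun α _ => ?_
    rw [Finset.mul_sum]
    refine Finset.sum_congr rfl fun β _ => ?_
    have : Complex.exp ((s + (α - β : ℝ) * Complex.I) * X ω) = Complex.exp (s * X ω) *
        (Complex.exp (α * X ω * Complex.I) * Complex.exp (conj (β * X ω * Complex.I : ℂ))) := by
      rw [← Complex.exp_add, ← Complex.exp_add]
      congr 1
      simp only [map_mul, Complex.conj_I, Complex.conj_ofReal]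
      push_cast
      ring
    rw [← Complex.exp_conj, this]
    push_cast
    ring
  simp only [hsq, RCLike.re_to_complex, Complex.re_ofReal_mul, Pi.zero_apply]
  exact mul_nonneg (mul_nonneg (by linarith) (Real.exp_pos _).le)
    (re_sum_mul_conj_kernel_nonneg ha A fun α => Complex.exp (α * X ω * Complex.I))

end general

end LittlewoodPi

namespace LittlewoodPi

open MeasureTheory Set Filter Topology Metric ProbabilityTheory ComplexConjugate

variable {ε C : ℝ}

theorem mem_interior_mellinSet (hε : |ε| = 1) (hS : ∀ t, 1 ≤ t → 0 ≤ defectSum ε C t) {s : ℝ}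
    (hs : 1 / 2 < s) : s ∈ interior (mellinSet (defectSum ε C)) := by
  have := interior_mono (Ioi_half_subset_mellinSet hε hS)
  rw [interior_Ioi] at this
  exact this hs

theorem deriv_mul_mellinOne_eq (hε : |ε| = 1) (hS : ∀ t, 1 ≤ t → 0 ≤ defectSum ε C t) {s : ℂ}
    (hs : 1 / 2 < s.re) : deriv (fun s => s * mellinOne (defectSum ε C) s) s =
      mellinOne (defectSum ε C) s + s * deriv (mellinOne (defectSum ε C)) s := by
  have h1 : HasDerivAt (mellinOne (defectSum ε C)) (deriv (mellinOne (defectSum ε C)) s) s :=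
    ((differentiableOn_mellinOne (Ioi_half_subset_mellinSet hε hS)).differentiableAt
      ((isOpen_re_gt _).mem_nhds hs)).hasDerivAt
  refine ((hasDerivAt_id s).mul h1).deriv.trans ?_
  simp

theorem mgf_le_add_norm_deriv (hε : |ε| = 1) (hS : ∀ t, 1 ≤ t → 0 ≤ defectSum ε C t) {s K : ℝ}
    (hs : 1 / 2 < s) (hK : 4 ≤ K) :
    mgf (fun t => -Real.log t) (mellinMeasure (defectSum ε C)) s ≤
      2 * (Real.exp (2 * K) * mgf (fun t => -Real.log t) (mellinMeasure (defectSum ε C)) 2) +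
      4 / K * ‖deriv (fun s => s * mellinOne (defectSum ε C) s) s‖ := by
  set μ := mellinMeasure (defectSum ε C)
  set X : ℝ → ℝ := fun t => -Real.log t
  set M := mgf X μ s
  set D := ‖deriv (fun s => s * mellinOne (defectSum ε C) s) (s : ℂ)‖ with hD
  have hsI := mem_interior_mellinSet hε hS hs
  have h1 := mgf_le_add_integral (X := X) (μ := μ) mellinMeasure_ae_nonpos (by linarith) two_pos hsI
    (interior_subset (mem_interior_mellinSet hε hS (by norm_num : (1 / 2 : ℝ) < 2)))
    (by linarith : 0 < K)
  set J := ∫ ω, X ω * Real.exp (s * X ω) ∂μ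
  have hre : ((s : ℂ)).re ∈ interior (integrableExpSet X μ) := hsI
  have hJ : deriv (mellinOne (defectSum ε C)) s = (J : ℂ) := by
    rw [mellinOne, (hasDerivAt_complexMGF hre).deriv]
    simp only [J]
    rw [← integral_complex_ofReal]
    congr 1
    ext ω
    push_cast
    rfl
  have h2 : (s : ℂ) * J = deriv (fun s => s * mellinOne (defectSum ε C) s) (s : ℂ) - M := by
    rw [deriv_mul_mellinOne_eq hε hS (by simpa using hs), hJ, mellinOne, complexMGF_ofReal]
    ring
  have hM : 0 ≤ M := mgf_nonneg
  have h3 : s * -J ≤ D + M := by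
    have := congrArg norm h2
    rw [← Complex.ofReal_mul, Complex.norm_real] at this
    calc s * -J ≤ ‖s * J‖ := by rw [Real.norm_eq_abs]; linarith [neg_abs_le (s * J)]
      _ ≤ D + ‖(M : ℂ)‖ := by rw [this]; exact norm_sub_le _ _
      _ = D + M := by rw [Complex.norm_real, Real.norm_of_nonneg hM]
  have hD0 : 0 ≤ D := norm_nonneg _
  have h4 : -J ≤ 2 * (D + M) := by
    by_contra! hcon
    nlinarith
  have hK0 : 0 < K := by linarith
  have h5 : -J / K ≤ 2 * (D + M) / K := div_le_div_of_nonneg_right h4 hK0.le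
  have h6 : 2 * (D + M) / K ≤ 2 / K * D + M / 2 := by
    rw [mul_div_right_comm, mul_add]
    have : 2 / K ≤ 1 / 2 := by rw [div_le_div_iff₀ hK0 two_pos]; linarith
    nlinarith
  rw [neg_div] at h5
  have h7 : 4 / K * D = 2 * (2 / K * D) := by ring
  rw [h7]
  linarith

theorem tendsto_mul_mgf (hε : |ε| = 1) (hS : ∀ t, 1 ≤ t → 0 ≤ defectSum ε C t) :
    Tendsto (fun σ : ℝ => σ * mgf (fun t => -Real.log t) (mellinMeasure (defectSum ε C))
      (1 / 2 + σ)) (𝓝[>] 0) (𝓝 0) := by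
  have hlim := (tendsto_mul_deriv hε hS 0).norm
  set B : ℝ := ‖(-(ε * residueAt 0) : ℂ)‖ + 1
  have hB : ∀ᶠ σ : ℝ in 𝓝[>] 0, ‖(σ : ℂ) * deriv (fun s => s * mellinOne (defectSum ε C) s)
      (1 / 2 + σ + (0 : ℝ) * Complex.I)‖ < B := hlim.eventually (gt_mem_nhds (lt_add_one _))
  have hBpos : 0 < B := by positivity
  rw [Metric.tendsto_nhds]
  intro δ hδ
  set K : ℝ := max 4 (8 * B / δ)
  have hK4 : 4 ≤ K := le_max_left _ _
  have hKB : 4 / K * B ≤ δ / 2 := by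
    have : 8 * B / δ ≤ K := le_max_right _ _
    rw [div_le_iff₀ hδ] at this
    rw [div_mul_eq_mul_div, div_le_iff₀ (by linarith)]
    linarith
  set M := 2 * (Real.exp (2 * K) * mgf (fun t => -Real.log t) (mellinMeasure (defectSum ε C)) 2)
  have hM : ∀ᶠ σ : ℝ in 𝓝[>] 0, σ * M < δ / 2 := by
    have : Tendsto (fun σ : ℝ => σ * M) (𝓝 0) (𝓝 (0 * M)) := tendsto_id.mul_const M
    rw [zero_mul] at this
    exact (this.mono_left nhdsWithin_le_nhds).eventually (gt_mem_nhds (by positivity))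
  filter_upwards [hB, hM, self_mem_nhdsWithin] with σ h1 h2 hσ
  have hσ' : (0 : ℝ) < σ := hσ
  have h3 := mgf_le_add_norm_deriv hε hS (s := 1 / 2 + σ) (by linarith) hK4
  rw [Real.dist_eq, sub_zero, abs_of_nonneg (mul_nonneg hσ'.le mgf_nonneg)]
  rw [norm_mul, Complex.norm_real, Real.norm_of_nonneg hσ'.le] at h1
  have h4 : (1 / 2 + σ + (0 : ℝ) * Complex.I : ℂ) = ((1 / 2 + σ : ℝ) : ℂ) := by push_cast; ring
  rw [h4] at h1
  have h5 := mul_le_mul_of_nonneg_left h3 hσ'.le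
  have h6 : 0 ≤ 4 / K := by positivity
  have h7 := mul_le_mul_of_nonneg_left h1.le h6
  nlinarith

theorem tendsto_mul_neg_deriv_mellinOne (hε : |ε| = 1) (hS : ∀ t, 1 ≤ t → 0 ≤ defectSum ε C t)
    (l : ℝ) :
    Tendsto (fun σ : ℝ => (σ : ℂ) * -deriv (mellinOne (defectSum ε C)) (1 / 2 + σ + l * Complex.I))
      (𝓝[>] 0) (𝓝 (ε * residueAt l / (1 / 2 + l * Complex.I))) := by
  have h0 : Tendsto (fun σ : ℝ => (σ : ℂ) * mellinOne (defectSum ε C) (1 / 2 + σ + l * Complex.I))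
      (𝓝[>] 0) (𝓝 0) := by
    refine squeeze_zero_norm' ?_ (tendsto_mul_mgf hε hS)
    filter_upwards [self_mem_nhdsWithin] with σ hσ
    rw [norm_mul, Complex.norm_real, Real.norm_of_nonneg (le_of_lt hσ)]
    refine mul_le_mul_of_nonneg_left (norm_complexMGF_le_mgf.trans_eq ?_) (le_of_lt hσ)
    simp
  have hs : Tendsto (fun σ : ℝ => (1 / 2 + σ + l * Complex.I : ℂ)) (𝓝[>] 0)
      (𝓝 (1 / 2 + l * Complex.I)) := by
    simpa using (tendsto_ofReal_nhdsGT_zero.const_add (1 / 2 : ℂ)).add_const (l * Complex.I)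
  have hne : (1 / 2 + l * Complex.I : ℂ) ≠ 0 := fun h => by
    have := congrArg Complex.re h
    simp at this
  have h1 := (h0.sub (tendsto_mul_deriv hε hS l)).div hs hne
  rw [zero_sub, neg_neg] at h1
  refine h1.congr' ?_
  filter_upwards [self_mem_nhdsWithin] with σ hσ
  have hσ' : (0 : ℝ) < σ := hσ
  have hs' : 1 / 2 < (1 / 2 + (σ : ℂ) + l * Complex.I).re := by simp [hσ']
  rw [Pi.div_apply, deriv_mul_mellinOne_eq hε hS hs']
  have hs0 : (1 / 2 + (σ : ℂ) + l * Complex.I) ≠ 0 := fun h => by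
    rw [h] at hs'
    norm_num at hs'
  generalize (1 / 2 + (σ : ℂ) + l * Complex.I) = s at *
  field_simp
  ring

/-- The positive-definite function attached to the zeros of `xi`. -/
noncomputable def zeroKernel (a l : ℝ) : ℝ :=
  (residueAt l / (1 / 2 + l * Complex.I) * (a / (a + l * Complex.I)) : ℂ).re

theorem mul_sum_zeroKernel_nonneg (hε : |ε| = 1) (hS : ∀ t, 1 ≤ t → 0 ≤ defectSum ε C t) {a : ℝ}
    (ha : 0 < a) (A : Finset ℝ) :
    0 ≤ ε * ∑ α ∈ A, ∑ β ∈ A, zeroKernel a (α - β) := by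
  have hlim : Tendsto (fun σ : ℝ => ((σ : ℂ) * ∑ α ∈ A, ∑ β ∈ A,
      (a / (a + (α - β : ℝ) * Complex.I) : ℂ) *
      -deriv (mellinOne (defectSum ε C)) (1 / 2 + σ + (α - β : ℝ) * Complex.I)).re) (𝓝[>] 0)
      (𝓝 (∑ α ∈ A, ∑ β ∈ A, (a / (a + (α - β : ℝ) * Complex.I) : ℂ) *
        (ε * residueAt (α - β) / (1 / 2 + (α - β : ℝ) * Complex.I))).re) := by
    refine (Complex.continuous_re.tendsto _).comp ?_
    simp only [Finset.mul_sum]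
    refine tendsto_finsetSum _ fun α _ => tendsto_finsetSum _ fun β _ => ?_
    refine ((tendsto_mul_neg_deriv_mellinOne hε hS (α - β)).const_mul _).congr fun σ => ?_
    ring
  have hval : (∑ α ∈ A, ∑ β ∈ A, (a / (a + (α - β : ℝ) * Complex.I) : ℂ) *
      (ε * residueAt (α - β) / (1 / 2 + (α - β : ℝ) * Complex.I))).re =
      ε * ∑ α ∈ A, ∑ β ∈ A, zeroKernel a (α - β) := by
    simp only [Complex.re_sum, Finset.mul_sum, zeroKernel]
    refine Finset.sum_congr rfl fun α _ => Finset.sum_congr rfl fun β _ => ?_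
    rw [← Complex.re_ofReal_mul]
    congr 1
    ring
  rw [← hval]
  refine ge_of_tendsto hlim ?_
  filter_upwards [self_mem_nhdsWithin] with σ hσ
  have hσ' : (0 : ℝ) < σ := hσ
  rw [Complex.re_ofReal_mul]
  have := re_sum_mul_neg_deriv_complexMGF_nonneg (X := fun t => -Real.log t)
    (μ := mellinMeasure (defectSum ε C)) mellinMeasure_ae_nonpos
    (mem_interior_mellinSet hε hS (by linarith : 1 / 2 < 1 / 2 + σ)) ha A
  push_cast at this ⊢
  exact mul_nonneg hσ'.le this

theorem zeroKernel_zero {a : ℝ} (ha : 0 < a) : zeroKernel a 0 = 1 := by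
  have : (a : ℂ) ≠ 0 := by exact_mod_cast ha.ne'
  simp [zeroKernel, residueAt, zeroOrder_zero, this]

theorem zeroKernel_of_ne_zero {a l : ℝ} (ha : 0 < a) (hl : l ≠ 0) :
    zeroKernel a l =
      -(zeroOrder l * (a * (l ^ 2 - a / 2) / ((1 / 4 + l ^ 2) * (a ^ 2 + l ^ 2)))) := by
  have h1 : (residueAt l / (1 / 2 + l * Complex.I) * (a / (a + l * Complex.I)) : ℂ) =
      ((zeroOrder l * a / ((1 / 4 + l ^ 2) * (a ^ 2 + l ^ 2)) : ℝ) : ℂ) *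
        ((1 / 2 - l * Complex.I) * (a - l * Complex.I)) := by
    have hI := Complex.I_sq
    have h2 : (1 / 2 + l * Complex.I : ℂ) ≠ 0 := fun h => by simpa using congrArg Complex.re h
    have h3 : (a + l * Complex.I : ℂ) ≠ 0 := fun h => ha.ne' (by simpa using congrArg Complex.re h)
    have h4 : ((1 / 4 + l ^ 2) * (a ^ 2 + l ^ 2) : ℂ) ≠ 0 := by
      have : (((1 / 4 + l ^ 2) * (a ^ 2 + l ^ 2) : ℝ) : ℂ) ≠ 0 :=
        Complex.ofReal_ne_zero.2 (by positivity)
      push_cast at this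
      exact this
    rw [residueAt, if_neg hl, add_zero]
    push_cast
    rw [div_mul_div_comm, div_mul_eq_mul_div, div_eq_div_iff (mul_ne_zero h2 h3) h4]
    have h5 : (1 / 4 + l ^ 2 : ℂ) = (1 / 2 + l * Complex.I) * (1 / 2 - l * Complex.I) := by
      linear_combination (l ^ 2 : ℂ) * hI
    have h6 : (a ^ 2 + l ^ 2 : ℂ) = (a + l * Complex.I) * (a - l * Complex.I) := by
      linear_combination (l ^ 2 : ℂ) * hI
    rw [h5, h6]
    ring
  rw [zeroKernel, h1, Complex.re_ofReal_mul]
  simp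
  ring

end LittlewoodPi

namespace LittlewoodPi

open MeasureTheory Set Filter Topology Metric

theorem not_forall_defectSum_neg_one_nonneg (C : ℝ) : ¬ ∀ t, 1 ≤ t → 0 ≤ defectSum (-1) C t := by
  intro hS
  have := mul_sum_zeroKernel_nonneg (by norm_num) hS one_pos {0}
  norm_num [zeroKernel_zero one_pos] at this

theorem differentiable_xi_half_add : Differentiable ℂ fun z => xi (1 / 2 + z) :=
  differentiable_xi.comp (by fun_prop)

theorem xi_half_ne_zero : xi (1 / 2 + 0) ≠ 0 := by
  rw [add_zero, Ne, xi_eq_zero_iff (by norm_num)]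
  have := zetaMul_ofReal_ne_zero (σ := 1 / 2) (by norm_num)
  push_cast at this
  exact this

theorem xi_eq_zero_of_zeroOrder_ne_zero {l : ℝ} (hl : zeroOrder l ≠ 0) :
    xi (1 / 2 + l * Complex.I) = 0 := by
  by_contra h
  refine hl ?_
  rw [zeroOrder, analyticOrderNatAt,
    (differentiable_xi_half_add.analyticAt _).analyticOrderAt_eq_zero.2 h, ENat.toNat_zero]

theorem finite_zeroOrder_ne_zero (R : ℝ) : {l : ℝ | |l| ≤ R ∧ zeroOrder l ≠ 0}.Finite := by
  refine Set.Finite.of_finite_image (f := fun l : ℝ => (l : ℂ) * Complex.I)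
    ((finite_zeros_closedBall differentiable_xi_half_add xi_half_ne_zero R).subset ?_) ?_
  · rintro _ ⟨l, ⟨hl, hl0⟩, rfl⟩
    refine ⟨by simpa using hl, xi_eq_zero_of_zeroOrder_ne_zero hl0⟩
  · intro a _ b _ h
    simpa using h

theorem exists_sq_ge_of_zeroOrder_ne_zero :
    ∃ r : ℝ, 0 < r ∧ r ≤ 1 ∧ ∀ l, zeroOrder l ≠ 0 → r ≤ l ^ 2 := by
  have h := differentiable_xi_half_add.continuous.continuousAt.eventually_ne xi_half_ne_zero
  obtain ⟨r, hr, hball⟩ := Metric.eventually_nhds_iff.1 h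
  refine ⟨min 1 (r ^ 2), by positivity, min_le_left _ _, fun l hl => ?_⟩
  refine (min_le_right _ _).trans ?_
  rw [← sq_abs l]
  refine pow_le_pow_left₀ hr.le ?_ 2
  by_contra! hlt
  exact hball (y := l * Complex.I) (by simpa using hlt) (xi_eq_zero_of_zeroOrder_ne_zero hl)

variable {C : ℝ}

theorem exists_sum_neg_zeroKernel_le (hS : ∀ t, 1 ≤ t → 0 ≤ defectSum 1 C t) {a : ℝ}
    (ha : 0 < a) {Γ : Finset ℝ} (h0 : (0 : ℝ) ∉ Γ) :
    ∃ Γ', Γ ⊆ Γ' ∧ (0 : ℝ) ∉ Γ' ∧ ∑ l ∈ Γ', -zeroKernel a l ≤ 1 := by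
  classical
  set Γ₀ := (finite_zeroOrder_ne_zero √(a / 2)).toFinset
  have h0' : (0 : ℝ) ∉ Γ ∪ Γ₀ := by
    rw [Finset.mem_union, not_or]
    refine ⟨h0, ?_⟩
    simp [Γ₀, zeroOrder_zero]
  refine ⟨Γ ∪ Γ₀, Finset.subset_union_left, h0', ?_⟩
  have := sum_nonneg_of_posDef (ψ := zeroKernel a)
    (fun A => by simpa using mul_sum_zeroKernel_nonneg (by norm_num) hS ha A) h0' ?_
  · rw [zeroKernel_zero ha] at this
    rw [Finset.sum_neg_distrib]
    linarith
  · intro l hl hlΓ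
    rw [zeroKernel_of_ne_zero ha hl, neg_nonpos]
    rcases Nat.eq_zero_or_pos (zeroOrder l) with hm | hm
    · simp [hm]
    · have hlΓ₀ : l ∉ Γ₀ := fun h => hlΓ (Finset.mem_union_right _ h)
      have : a / 2 ≤ l ^ 2 := by
        by_contra! hlt
        refine hlΓ₀ ?_
        simp only [Γ₀, Set.Finite.mem_toFinset, mem_ofPred_eq]
        exact ⟨Real.abs_le_sqrt hlt.le, hm.ne'⟩
      have : 0 ≤ l ^ 2 - a / 2 := by linarith
      positivity

theorem exists_sum_zeroOrder_div_le (hS : ∀ t, 1 ≤ t → 0 ≤ defectSum 1 C t) :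
    ∃ B, 0 ≤ B ∧ ∀ Γ : Finset ℝ, (0 : ℝ) ∉ Γ → ∑ l ∈ Γ, zeroOrder l / (1 / 4 + l ^ 2) ≤ B := by
  obtain ⟨a, ha, ha1, hmin⟩ := exists_sq_ge_of_zeroOrder_ne_zero
  refine ⟨4 / a, by positivity, fun Γ h0 => ?_⟩
  obtain ⟨Γ', hsub, h0', hle⟩ := exists_sum_neg_zeroKernel_le hS ha h0
  have hterm (l : ℝ) (hl : l ∈ Γ') :
      (zeroOrder l / (1 / 4 + l ^ 2) : ℝ) ≤ 4 / a * -zeroKernel a l := by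
    have hl0 : l ≠ 0 := fun h => h0' (h ▸ hl)
    rw [zeroKernel_of_ne_zero ha hl0, neg_neg]
    rcases Nat.eq_zero_or_pos (zeroOrder l) with hm | hm
    · simp [hm]
    · have h1 := hmin l hm.ne'
      have h2 : 1 ≤ 4 * (l ^ 2 - a / 2) / (a ^ 2 + l ^ 2) := by
        rw [le_div_iff₀ (by positivity)]
        nlinarith
      calc (zeroOrder l / (1 / 4 + l ^ 2) : ℝ)
          ≤ zeroOrder l / (1 / 4 + l ^ 2) * (4 * (l ^ 2 - a / 2) / (a ^ 2 + l ^ 2)) :=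
            le_mul_of_one_le_right (by positivity) h2
        _ = _ := by field_simp
  calc ∑ l ∈ Γ, (zeroOrder l / (1 / 4 + l ^ 2) : ℝ)
      ≤ ∑ l ∈ Γ', (zeroOrder l / (1 / 4 + l ^ 2) : ℝ) :=
        Finset.sum_le_sum_of_subset_of_nonneg hsub fun _ _ _ => by positivity
    _ ≤ ∑ l ∈ Γ', 4 / a * -zeroKernel a l := Finset.sum_le_sum hterm
    _ = 4 / a * ∑ l ∈ Γ', -zeroKernel a l := by rw [Finset.mul_sum]
    _ ≤ 4 / a := mul_le_of_le_one_right (by positivity) hle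

theorem sum_zeroOrder_mul_div_le (hS : ∀ t, 1 ≤ t → 0 ≤ defectSum 1 C t) {B : ℝ}
    (hB : ∀ Γ : Finset ℝ, (0 : ℝ) ∉ Γ → ∑ l ∈ Γ, zeroOrder l / (1 / 4 + l ^ 2) ≤ B) {a : ℝ}
    (ha : 1 ≤ a) {Γ : Finset ℝ} (h0 : (0 : ℝ) ∉ Γ) :
    ∑ l ∈ Γ, zeroOrder l * (a / (l ^ 2 + a ^ 2)) ≤ 1 + B := by
  have ha0 : 0 < a := by linarith
  obtain ⟨Γ', hsub, h0', hle⟩ := exists_sum_neg_zeroKernel_le hS ha0 h0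
  have hterm (l : ℝ) (hl : l ∈ Γ') : (zeroOrder l * (a / (l ^ 2 + a ^ 2)) : ℝ) ≤
      -zeroKernel a l + zeroOrder l / (1 / 4 + l ^ 2) := by
    have hl0 : l ≠ 0 := fun h => h0' (h ▸ hl)
    rw [zeroKernel_of_ne_zero ha0 hl0, neg_neg, div_eq_mul_inv (zeroOrder l : ℝ), ← mul_add]
    refine mul_le_mul_of_nonneg_left ?_ (Nat.cast_nonneg _)
    rw [← sub_nonneg]
    have : a * (l ^ 2 - a / 2) / ((1 / 4 + l ^ 2) * (a ^ 2 + l ^ 2)) + (1 / 4 + l ^ 2)⁻¹ -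
        a / (l ^ 2 + a ^ 2) =
          (a ^ 2 / 2 + l ^ 2 - a / 4) / ((1 / 4 + l ^ 2) * (a ^ 2 + l ^ 2)) := by
      rw [add_comm (l ^ 2) (a ^ 2)]
      field_simp
      ring
    rw [this]
    have : 0 ≤ a ^ 2 / 2 + l ^ 2 - a / 4 := by nlinarith [sq_nonneg l]
    positivity
  calc ∑ l ∈ Γ, (zeroOrder l * (a / (l ^ 2 + a ^ 2)) : ℝ)
      ≤ ∑ l ∈ Γ', (zeroOrder l * (a / (l ^ 2 + a ^ 2)) : ℝ) :=
        Finset.sum_le_sum_of_subset_of_nonneg hsub fun _ _ _ => by positivity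
    _ ≤ ∑ l ∈ Γ', (-zeroKernel a l + zeroOrder l / (1 / 4 + l ^ 2)) := Finset.sum_le_sum hterm
    _ ≤ 1 + B := by
      rw [Finset.sum_add_distrib]
      exact add_le_add hle (hB Γ' h0')

theorem exists_sum_zeroOrder_mul_log_le (hS : ∀ t, 1 ≤ t → 0 ≤ defectSum 1 C t) :
    ∃ K, ∀ a, 1 ≤ a → ∀ Γ : Finset ℝ, (0 : ℝ) ∉ Γ →
      ∑ l ∈ Γ, zeroOrder l * Real.log (1 + a ^ 2 / l ^ 2) ≤ K * a := by
  obtain ⟨B, hB0, hB⟩ := exists_sum_zeroOrder_div_le hS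
  obtain ⟨r, hr, -, hmin⟩ := exists_sq_ge_of_zeroOrder_ne_zero
  refine ⟨(1 + 1 / (4 * r)) * B + 2 * (1 + B), fun a ha Γ h0 => ?_⟩
  have hne (l : ℝ) (hl : l ∈ Γ) : l ≠ 0 := fun h => h0 (h ▸ hl)
  set Ψ : ℝ → ℝ := fun a => ∑ l ∈ Γ, zeroOrder l * Real.log (1 + a ^ 2 / l ^ 2) with hΨ
  have hder (x : ℝ) : HasDerivAt Ψ (2 * ∑ l ∈ Γ, zeroOrder l * (x / (l ^ 2 + x ^ 2))) x := by
    rw [Finset.mul_sum]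
    refine HasDerivAt.fun_sum fun l hl => ?_
    have hl0 := hne l hl
    have hpos : 1 + x ^ 2 / l ^ 2 ≠ 0 := by positivity
    refine ((((((hasDerivAt_id x).pow 2).div_const (l ^ 2)).const_add 1).log
      hpos).const_mul (zeroOrder l : ℝ)).congr_deriv ?_
    simp only [id]
    have : l ^ 2 + x ^ 2 ≠ 0 := by positivity
    field_simp
    simp [mul_div_assoc, div_self this]
  have hΨ1 : Ψ 1 ≤ (1 + 1 / (4 * r)) * B := by
    refine le_trans ?_ (mul_le_mul_of_nonneg_left (hB Γ h0) (by positivity))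
    rw [Finset.mul_sum]
    refine Finset.sum_le_sum fun l hl => ?_
    have hl0 := hne l hl
    rcases Nat.eq_zero_or_pos (zeroOrder l) with hm | hm
    · simp [hm]
    · have h1 := hmin l hm.ne'
      rw [mul_div_left_comm]
      refine mul_le_mul_of_nonneg_left ?_ (Nat.cast_nonneg _)
      have h2 : Real.log (1 + 1 ^ 2 / l ^ 2) ≤ 1 / l ^ 2 := by
        refine (Real.log_le_sub_one_of_pos (by positivity)).trans_eq ?_
        ring
      refine h2.trans ?_
      have h3 : 1 / (4 * l ^ 2) ≤ 1 / (4 * r) := by gcongr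
      rw [le_div_iff₀ (by positivity)]
      have h4 : 1 / l ^ 2 * (1 / 4 + l ^ 2) = 1 + 1 / (4 * l ^ 2) := by field_simp; ring
      rw [h4]
      linarith
  have hmv := (convex_Ici (1 : ℝ)).image_sub_le_mul_sub_of_deriv_le (f := Ψ) (C := 2 * (1 + B))
    (fun x _ => (hder x).continuousAt.continuousWithinAt)
    (fun x _ => (hder x).differentiableAt.differentiableWithinAt)
    (fun x hx => by
      rw [interior_Ici] at hx
      rw [(hder x).deriv]
      have := sum_zeroOrder_mul_div_le hS hB (le_of_lt (mem_Ioi.1 hx)) h0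
      linarith) 1 self_mem_Ici a ha ha
  have h5 : 0 ≤ (1 + 1 / (4 * r)) * B := by positivity
  change Ψ a ≤ _
  nlinarith

theorem exists_norm_sq_xi_le (hS : ∀ t, 1 ≤ t → 0 ≤ defectSum 1 C t) :
    ∃ K, ∀ a : ℝ, 1 ≤ a → ‖xi (1 / 2 + a)‖ ^ 2 ≤ ‖xi (1 / 2 + 0)‖ ^ 2 * Real.exp (K * a) := by
  classical
  obtain ⟨K, hK⟩ := exists_sum_zeroOrder_mul_log_le hS
  have hre (z : ℂ) (hz : xi (1 / 2 + z) = 0) : z.re = 0 :=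
    re_eq_zero_of_xi_half_add_eq_zero (by norm_num) hS hz
  refine ⟨K, fun a ha => ?_⟩
  refine norm_sq_le_of_sum_log_le (f := fun z => xi (1 / 2 + z)) (C := 48)
    differentiable_xi_half_add
    (fun z => ?_) xi_half_ne_zero (fun R hR z hz => norm_xi_half_add_le hR hz) hre
    (by linarith) fun s hs => ?_
  · rw [← xi_one_sub]
    congr 1
    ring
  · have hw (w : ℂ) (h : w ∈ s) : (w.im : ℂ) * Complex.I = w := by
      apply Complex.ext <;> simp [hre w (hs w h)]
    have hinj : InjOn Complex.im s := fun u hu v hv h => by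
      rw [← hw u hu, ← hw v hv, h]
    have h0 : (0 : ℝ) ∉ s.image Complex.im := by
      rw [Finset.mem_image]
      rintro ⟨w, hws, h⟩
      have h1 := hs w hws
      rw [← hw w hws, h, Complex.ofReal_zero, zero_mul] at h1
      exact xi_half_ne_zero h1
    refine le_trans (le_of_eq ?_) (hK a ha _ h0)
    rw [Finset.sum_image hinj]
    refine Finset.sum_congr rfl fun w h => ?_
    rw [zeroOrder, hw w h]

theorem factorial_le_norm_xi (m : ℕ) :
    (m.factorial : ℝ) ≤ Real.pi ^ (m + 1) * ‖xi ((2 * (m + 1) : ℕ) : ℂ)‖ := by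
  have h1 : 1 < 2 * (m + 1) := by omega
  have hne : ((2 * (m + 1) : ℕ) : ℂ) ≠ 1 := by exact_mod_cast h1.ne'
  rw [xi_eq_mul_zetaMul (by rw [Complex.natCast_re]; positivity), zetaMul_of_ne_one hne,
    Complex.Gammaℝ_def, zeta_nat_eq_tsum_of_gt_one h1]
  have h2 : ((2 * (m + 1) : ℕ) : ℂ) / 2 = (m : ℂ) + 1 := by push_cast; ring
  have h3 : -((2 * (m + 1) : ℕ) : ℂ) / 2 = -((m + 1 : ℕ) : ℂ) := by push_cast; ring
  rw [h2, h3, Complex.Gamma_nat_eq_factorial, Complex.cpow_neg, Complex.cpow_natCast]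
  have h4 : (∑' n : ℕ, 1 / (n : ℂ) ^ (2 * (m + 1))) =
      ((∑' n : ℕ, 1 / (n : ℝ) ^ (2 * (m + 1)) : ℝ) : ℂ) := by push_cast; rfl
  have h5 : 1 ≤ ∑' n : ℕ, 1 / (n : ℝ) ^ (2 * (m + 1)) := by
    have := (Real.summable_one_div_nat_pow.2 h1).le_tsum 1 fun _ _ => by positivity
    simpa using this
  have h6 : ((2 * (m + 1) : ℕ) : ℂ) - 1 = ((2 * m + 1 : ℕ) : ℂ) := by push_cast; ring
  rw [h4, h6]
  simp only [norm_mul, norm_inv, norm_pow, Complex.norm_real, Complex.norm_natCast,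
    Real.norm_of_nonneg Real.pi_pos.le, Real.norm_of_nonneg (zero_le_one.trans h5)]
  set Z := ∑' n : ℕ, 1 / (n : ℝ) ^ (2 * (m + 1))
  have hpi := Real.pi_pos
  have h7 : Real.pi ^ (m + 1) * (((2 * (m + 1) : ℕ) : ℝ) * ((Real.pi ^ (m + 1))⁻¹ * m.factorial) *
      (((2 * m + 1 : ℕ) : ℝ) * Z)) =
      m.factorial * ((((2 * (m + 1) : ℕ) : ℝ) * ((2 * m + 1 : ℕ) : ℝ)) * Z) := by
    field_simp
  rw [h7]
  refine le_mul_of_one_le_right (Nat.cast_nonneg _) ?_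
  have h8 : (1 : ℝ) ≤ ((2 * (m + 1) : ℕ) : ℝ) * ((2 * m + 1 : ℕ) : ℝ) := by
    exact_mod_cast Nat.mul_pos (by omega) (by omega)
  exact one_le_mul_of_one_le_of_one_le h8 h5

theorem not_forall_defectSum_one_nonneg (C : ℝ) : ¬ ∀ t, 1 ≤ t → 0 ≤ defectSum 1 C t := by
  intro hS
  obtain ⟨K, hK⟩ := exists_norm_sq_xi_le hS
  set Q := ‖xi (1 / 2 + 0)‖ ^ 2
  set E := Real.pi ^ 2 * Real.exp (2 * |K|) with hE
  have hpi := Real.pi_pos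
  have hbound (m : ℕ) : (m.factorial : ℝ) ≤ Q * E * E ^ m := by
    have h1 := factorial_le_norm_xi m
    have h2 := hK ((2 * m + 3 / 2 : ℝ)) (by linarith [(Nat.cast_nonneg m : (0 : ℝ) ≤ m)])
    have h3 : (1 / 2 + ((2 * m + 3 / 2 : ℝ) : ℂ)) = ((2 * (m + 1) : ℕ) : ℂ) := by push_cast; ring
    rw [h3] at h2
    have h4 : Real.exp (K * (2 * m + 3 / 2)) ≤ Real.exp (2 * |K|) ^ (m + 1) := by
      rw [← Real.exp_nat_mul, Real.exp_le_exp]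
      push_cast
      have hm : (0 : ℝ) ≤ 2 * m + 3 / 2 := by positivity
      nlinarith [mul_le_mul_of_nonneg_right (le_abs_self K) hm, abs_nonneg K]
    have h5 : (1 : ℝ) ≤ m.factorial := by exact_mod_cast m.factorial_pos
    calc (m.factorial : ℝ) ≤ (m.factorial : ℝ) ^ 2 := by nlinarith
      _ ≤ (Real.pi ^ (m + 1) * ‖xi ((2 * (m + 1) : ℕ) : ℂ)‖) ^ 2 :=
        pow_le_pow_left₀ (by linarith) h1 2
      _ = (Real.pi ^ 2) ^ (m + 1) * ‖xi ((2 * (m + 1) : ℕ) : ℂ)‖ ^ 2 := by ring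
      _ ≤ (Real.pi ^ 2) ^ (m + 1) * (Q * Real.exp (2 * |K|) ^ (m + 1)) := by
        refine mul_le_mul_of_nonneg_left (h2.trans ?_) (by positivity)
        exact mul_le_mul_of_nonneg_left h4 (by positivity)
      _ = Q * E * E ^ m := by rw [hE]; ring
  have hlim := (FloorSemiring.tendsto_pow_div_factorial_atTop E).const_mul (Q * E)
  rw [mul_zero] at hlim
  obtain ⟨m, hm⟩ := (hlim.eventually (gt_mem_nhds one_pos)).exists
  have hf : (0 : ℝ) < m.factorial := by exact_mod_cast m.factorial_pos
  rw [← mul_div_assoc, div_lt_one hf] at hm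
  linarith [hbound m]

end LittlewoodPi

/-- Littlewood: π(x) − Li(x) changes sign infinitely often. -/
theorem pi_sub_li_changes_sign_infinitely_often :
    ∀ X : ℝ, (∃ x : ℝ, X < x ∧ Li x < (primePi x : ℝ)) ∧
      (∃ y : ℝ, X < y ∧ (primePi y : ℝ) < Li y) := by
  intro X
  constructor
  · by_contra! h
    obtain ⟨C, hC⟩ := LittlewoodPi.exists_defectSum_nonneg_of_le h
    exact LittlewoodPi.not_forall_defectSum_one_nonneg C hC
  · by_contra! h
    obtain ⟨C, hC⟩ := LittlewoodPi.exists_defectSum_nonneg_of_ge h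
    exact LittlewoodPi.not_forall_defectSum_neg_one_nonneg C hC
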